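/- Let k be a field, let X be a smooth proper integral separated scheme of finite type over k which is A¹-rigid, let Y be a smooth integral separated scheme of finite type over k, and let f : X → Y be a proper morphism which restricts to an isomorphism over a dense open subscheme of Y (i.e., f is a proper birational morphism). Then f is an isomorphism of schemes. (Hence the A¹-homotopy type of a smooth proper A¹-rigid k-variety is A¹-minimal.) -/

import Mathlib

open AlgebraicGeometry CategoryTheory CategoryTheory.Limits

noncomputable section

/-- The morphism `Spec S ⟶ Spec R` induced by a ring homomorphism `R →+* S`. -/
def specMapOf {R S : Type} [CommRing R] [CommRing S] (f : R →+* S) :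
    Spec (CommRingCat.of S) ⟶ Spec (CommRingCat.of R) :=
  Spec.map (CommRingCat.ofHom f)

/-- The structure morphism of the affine line `𝔸¹_k = Spec k[T]` over `k`. -/
def a1Struct (k : Type) [Field k] :
    Spec (CommRingCat.of (Polynomial k)) ⟶ Spec (CommRingCat.of k) :=
  specMapOf (Polynomial.C : k →+* Polynomial k)

/-- A smooth separated finite-type `k`-scheme `X` is *`𝔸¹`-rigid* if for every smooth separated
finite-type `k`-scheme `U` the precomposition with the projection `U ×ₖ 𝔸¹_k ⟶ U` is a
bijection `Hom_k(U, X) → Hom_k(U ×ₖ 𝔸¹_k, X)`. -/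
def A1Rigid (k : Type) [Field k] (X : Scheme) (sX : X ⟶ Spec (CommRingCat.of k)) : Prop :=
  ∀ (U : Scheme) (sU : U ⟶ Spec (CommRingCat.of k)),
    IsSmooth sU → IsSeparated sU → LocallyOfFiniteType sU → QuasiCompact sU →
    ((∀ f g : U ⟶ X, f ≫ sX = sU → g ≫ sX = sU →
        pullback.fst sU (a1Struct k) ≫ f = pullback.fst sU (a1Struct k) ≫ g → f = g) ∧
     (∀ h : pullback sU (a1Struct k) ⟶ X,
        h ≫ sX = pullback.fst sU (a1Struct k) ≫ sU →
        ∃ f : U ⟶ X, f ≫ sX = sU ∧ pullback.fst sU (a1Struct k) ≫ f = h))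

section

open TensorProduct IsLocalRing KaehlerDifferential

theorem formallySmooth_of_split {k R O : Type} [CommRing k] [CommRing R] [CommRing O]
    [Algebra k R] [Algebra R O] [Algebra k O]
    [IsScalarTower k R O]
    [Algebra.FormallySmooth k O]
    (l : Ω[O⁄k] →ₗ[O] O ⊗[R] Ω[R⁄k]) (hl : l ∘ₗ mapBaseChange k R O = LinearMap.id) :
    Algebra.FormallySmooth R O := by
  have hinj : Function.Injective (mapBaseChange k R O) :=
    Function.HasLeftInverse.injective ⟨l, LinearMap.congr_fun hl⟩
  constructor
  · have hex := exact_mapBaseChange_map k R O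
    have hsurj := KaehlerDifferential.map_surjective k R O
    have hsplit : Function.Injective (mapBaseChange k R O) ∧
        ∃ s, KaehlerDifferential.map k R O O ∘ₗ s = LinearMap.id :=
      ((Function.Exact.split_tfae' hex).out 1 0 :
        (Function.Surjective (KaehlerDifferential.map k R O O) ∧
          ∃ l, l ∘ₗ mapBaseChange k R O = LinearMap.id) ↔ _).mp ⟨hsurj, l, hl⟩
    obtain ⟨-, s, hs⟩ := hsplit
    exact Module.Projective.of_split s _ hs
  · constructor
    intro a b
    have key : ∀ a : Algebra.H1Cotangent R O, a = 0 := by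
      intro a
      have h1 : Algebra.H1Cotangent.δ k R O a = 0 := by
        apply hinj
        rw [map_zero]
        exact (Algebra.H1Cotangent.exact_δ_mapBaseChange k R O _).mpr ⟨a, rfl⟩
      obtain ⟨c, hc⟩ := (Algebra.H1Cotangent.exact_map_δ k R O _).mp h1
      rw [← hc, Subsingleton.elim c 0, map_zero]
    rw [key a, key b]

theorem formallySmooth_of_injective_residue {k R O : Type} [CommRing k] [CommRing R]
    [CommRing O] [IsLocalRing O]
    [Algebra k R] [Algebra R O] [Algebra k O]
    [IsScalarTower k R O]
    [Algebra.FormallySmooth k O] [Module.Finite R Ω[R⁄k]] [Module.Finite O Ω[O⁄k]]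
    (h : Function.Injective ((mapBaseChange k R O).lTensor (ResidueField O))) :
    Algebra.FormallySmooth R O := by
  have : Module.Free O Ω[O⁄k] := Module.free_of_flat_of_isLocalRing
  obtain ⟨l, hl⟩ := (IsLocalRing.split_injective_iff_lTensor_residueField_injective _).mpr h
  exact formallySmooth_of_split l hl

theorem algebraMap_bijective_of_flat {R O : Type} [CommRing R] [CommRing O] [IsDomain O]
    [IsLocalRing R] [IsLocalRing O] [Algebra R O]
    [IsLocalHom (algebraMap R O)] [Module.Flat R O]
    (h : ∀ a : O, ∃ r s : R, algebraMap R O s ≠ 0 ∧ algebraMap R O s * a = algebraMap R O r) :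
    Function.Bijective (algebraMap R O) := by
  have : Module.FaithfullyFlat R O := .of_flat_of_isLocalHom
  have hinj : Function.Injective (algebraMap R O) := FaithfulSMul.algebraMap_injective R O
  refine ⟨hinj, fun a ↦ ?_⟩
  obtain ⟨r, s, hs, h⟩ := h a
  have h2 : r ∈ ((Ideal.span {s}).map (algebraMap R O)).comap (algebraMap R O) := by
    rw [Ideal.mem_comap, Ideal.map_span, Set.image_singleton, ← h]
    exact Ideal.mul_mem_right _ _ (Ideal.subset_span rfl)
  rw [Ideal.comap_map_eq_self_of_faithfullyFlat] at h2
  obtain ⟨t, rfl⟩ := Ideal.mem_span_singleton'.mp h2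
  refine ⟨t, mul_left_cancel₀ hs ?_⟩
  rw [h, map_mul, mul_comm]

theorem isAdicComplete_sq {S : Type} [CommRing S] (I : Ideal S) [IsAdicComplete I S] :
    IsAdicComplete (I ^ 2) S where
  haus' x hx := IsHausdorff.haus' (I := I) x fun n ↦
    (hx n).mono (Submodule.smul_mono_left (by
      rw [← pow_mul]; exact Ideal.pow_le_pow_right (by omega)))
  prec' f hf := by
    obtain ⟨L, hL⟩ := IsPrecomplete.prec' (I := I) (fun n ↦ f ((n + 1) / 2)) fun {m n} h ↦
      (hf (m := (m + 1) / 2) (n := (n + 1) / 2) (by omega)).mono (Submodule.smul_mono_left (by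
        rw [← pow_mul]; exact Ideal.pow_le_pow_right (by omega)))
    refine ⟨L, fun n ↦ ?_⟩
    have := hL (2 * n)
    rwa [show (2 * n + 1) / 2 = n by omega, pow_mul] at this

open PowerSeries in
/-- A formally smooth algebra has an arc with prescribed origin and prescribed velocity. -/
theorem exists_arc {k R L : Type} [CommRing k] [CommRing R] [Field L] [Algebra k R]
    [Algebra k L] [Algebra.FormallySmooth k R] [Algebra R L] [IsScalarTower k R L]
    (D : Derivation k R L) :
    ∃ α : R →ₐ[k] PowerSeries L, (∀ r, constantCoeff (α r) = algebraMap R L r) ∧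
      ∀ r, coeff 1 (α r) = D r := by
  let I : Ideal (PowerSeries L) := Ideal.span {X} ^ 2
  have hmem : ∀ f : PowerSeries L, f ∈ I ↔ coeff 0 f = 0 ∧ coeff 1 f = 0 := by
    intro f
    simp only [I, Ideal.span_singleton_pow, Ideal.mem_span_singleton, X_pow_dvd_iff]
    exact ⟨fun h ↦ ⟨h 0 (by simp), h 1 (by simp)⟩, fun h m hm ↦ by
      interval_cases m; exacts [h.1, h.2]⟩
  have : IsAdicComplete I (PowerSeries L) := isAdicComplete_sq _
  let e : R → PowerSeries L := fun r ↦ C (algebraMap R L r) + C (D r) * X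
  have he0 : ∀ r, coeff 0 (e r) = algebraMap R L r := by intro r; simp [e]
  have he1 : ∀ r, coeff 1 (e r) = D r := by
    intro r
    simp only [e, map_add, coeff_C, coeff_C_mul, coeff_one_X]
    simp
  have hmul1 : ∀ f g : PowerSeries L,
      coeff 1 (f * g) = coeff 0 f * coeff 1 g + coeff 1 f * coeff 0 g := by
    intro f g
    rw [coeff_mul, Finset.Nat.antidiagonal_succ]
    simp
  have hmul0 : ∀ f g : PowerSeries L, coeff 0 (f * g) = coeff 0 f * coeff 0 g := by
    intro f g
    simp
  let φ : R →ₐ[k] PowerSeries L ⧸ I :=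
    { toFun := fun r ↦ Ideal.Quotient.mk I (e r)
      map_one' := by simp [e]
      map_zero' := by simp [e]
      map_add' := fun a b ↦ by
        rw [← map_add]; congr 1; simp only [e, map_add]; ring
      map_mul' := fun a b ↦ by
        rw [← map_mul, Ideal.Quotient.eq, hmem]
        simp only [map_sub, hmul1, he0, he1]
        constructor
        · rw [hmul0, he0, he0, map_mul, sub_self]
        · rw [Derivation.leibniz, Algebra.smul_def, Algebra.smul_def]; ring
      commutes' := fun a ↦ by
        rw [IsScalarTower.algebraMap_apply k (PowerSeries L) (PowerSeries L ⧸ I)]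
        simp only [e, Derivation.map_algebraMap, map_zero, zero_mul, add_zero,
          ← IsScalarTower.algebraMap_apply k R L]
        rw [PowerSeries.algebraMap_apply]
        rfl }
  obtain ⟨α, hα⟩ := Algebra.FormallySmooth.exists_mkₐ_comp_eq_of_isAdicComplete φ
  have h : ∀ r, α r - e r ∈ I := fun r ↦ Ideal.Quotient.eq.mp congr($hα r)
  simp only [hmem, map_sub, sub_eq_zero, he0, he1] at h
  exact ⟨α, fun r ↦ by rw [← coeff_zero_eq_constantCoeff_apply]; exact (h r).1, fun r ↦ (h r).2⟩

theorem exists_injective_of_infinite {κ L V : Type} [Field κ] [Field L] [Algebra κ L]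
    [AddCommGroup V] [Module κ V] [Module.Finite κ V] (h : ¬ Module.Finite κ L) :
    ∃ ψ : V →ₗ[κ] L, Function.Injective ψ := by
  have : Module.rank κ V ≤ Module.rank κ L :=
    (Module.rank_lt_aleph0 κ V).le.trans (not_lt.mp fun h' ↦ h (Module.rank_lt_aleph0_iff.mp h'))
  exact rank_le_iff_exists_linearMap.mp this

open PowerSeries in
theorem injective_residue_of_arc {k R O L : Type} [CommRing k] [CommRing R] [CommRing O]
    [IsLocalRing R] [IsLocalRing O] [Field L] [Algebra k R] [Algebra R O] [Algebra k O]
    [IsScalarTower k R O] [Algebra k L]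
    [Algebra (ResidueField R) L]
    (ψ : ResidueField R ⊗[R] Ω[R⁄k] →ₗ[ResidueField R] L) (hψ : Function.Injective ψ)
    (β : O →ₐ[k] PowerSeries L) [IsLocalHom β]
    (hβ1 : ∀ r, coeff 1 (β (algebraMap R O r)) = ψ (1 ⊗ₜ D k R r))
    (hβ0 : ∀ r, constantCoeff (β (algebraMap R O r)) = algebraMap (ResidueField R) L (residue R r))
    (hβ : ∀ b, ∃ c, constantCoeff (β b) = algebraMap (ResidueField R) L c) :
    Function.Injective ((mapBaseChange k R O).lTensor (ResidueField O)) := by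
  let ρ : O →+* L := constantCoeff.comp β
  have hρ : ∀ b, b ∈ maximalIdeal O → ρ b = 0 := by
    intro b hb
    by_contra h
    have : IsUnit (β b) := PowerSeries.isUnit_iff_constantCoeff.mpr (isUnit_iff_ne_zero.mpr h)
    exact hb (isUnit_of_map_unit β b this)
  let ρ' : ResidueField O →+* L := Ideal.Quotient.lift _ ρ hρ
  let : Algebra O L := ρ.toAlgebra
  let : Algebra (ResidueField O) L := ρ'.toAlgebra
  have : IsScalarTower O (ResidueField O) L := .of_algebraMap_eq fun _ ↦ rfl
  have : IsScalarTower k O L := .of_algebraMap_eq fun a ↦ by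
    change _ = constantCoeff (β _)
    rw [AlgHom.commutes, PowerSeries.algebraMap_apply]
    rfl
  have hmul1 : ∀ f g : PowerSeries L,
      coeff 1 (f * g) = constantCoeff f * coeff 1 g + constantCoeff g * coeff 1 f := by
    intro f g
    rw [coeff_mul, Finset.Nat.antidiagonal_succ]
    simp [mul_comm]
  let Dt : Derivation k O L :=
    { toFun := fun b ↦ coeff 1 (β b)
      map_add' := by simp
      map_smul' := fun a b ↦ by
        simp
      map_one_eq_zero' := by simp [coeff_one]
      leibniz' := fun a b ↦ by
        change coeff 1 (β (a * b)) = ρ a * coeff 1 (β b) + ρ b * coeff 1 (β a)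
        rw [map_mul, hmul1]; rfl }
  let Φ : ResidueField O ⊗[O] Ω[O⁄k] →ₗ[O] L :=
    TensorProduct.lift (LinearMap.mk₂ O (fun c ω ↦ c • Dt.liftKaehlerDifferential ω)
      (fun _ _ _ ↦ add_smul _ _ _) (fun _ _ _ ↦ smul_assoc _ _ _)
      (fun _ _ _ ↦ by rw [map_add, smul_add])
      (fun a c ω ↦ by rw [map_smul, smul_comm]))
  have hΦ : ∀ c b r, Φ ((mapBaseChange k R O).lTensor (ResidueField O) (c ⊗ₜ (b ⊗ₜ D k R r))) =
      ρ' c * (ρ b * ψ (1 ⊗ₜ D k R r)) := by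
    intro c b r
    simp only [LinearMap.lTensor_tmul, mapBaseChange_tmul, map_D, Φ, TensorProduct.lift.tmul,
      LinearMap.mk₂_apply, map_smul, Derivation.liftKaehlerDifferential_comp_D]
    rw [← hβ1, mul_left_comm]
    rfl
  have hloc : IsLocalHom (algebraMap R O) := by
    refine ⟨fun r hr ↦ ?_⟩
    have h1 : IsUnit (constantCoeff (β (algebraMap R O r))) :=
      (hr.map β).map constantCoeff
    rw [hβ0] at h1
    exact (residue_ne_zero_iff_isUnit r).mp fun h ↦ by simp [h] at h1
  have hj : ∀ c, ρ' (ResidueField.map (algebraMap R O) c) = algebraMap (ResidueField R) L c := by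
    intro c
    obtain ⟨r, rfl⟩ := residue_surjective c
    rw [← hβ0]
    rfl
  have hjs : Function.Surjective (ResidueField.map (algebraMap R O)) := by
    intro c
    obtain ⟨b, rfl⟩ := residue_surjective c
    obtain ⟨c, hc⟩ := hβ b
    exact ⟨c, ρ'.injective ((hj c).trans hc.symm)⟩
  let s : ResidueField R ⊗[R] Ω[R⁄k] →ₗ[R] ResidueField O ⊗[O] (O ⊗[R] Ω[R⁄k]) :=
    TensorProduct.lift (LinearMap.mk₂ R
      (fun c ω ↦ ResidueField.map (algebraMap R O) c ⊗ₜ (1 ⊗ₜ ω))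
      (fun _ _ _ ↦ by rw [map_add, add_tmul])
      (fun r c _ ↦ by
        rw [smul_tmul', Algebra.smul_def, Algebra.smul_def, map_mul]
        rfl)
      (fun _ _ _ ↦ by rw [tmul_add, tmul_add])
      (fun r c ω ↦ by rw [tmul_smul, tmul_smul]))
  have hs : Function.Surjective s := by
    intro z
    induction z with
    | zero => exact ⟨0, map_zero _⟩
    | add x y hx hy =>
      obtain ⟨x', rfl⟩ := hx
      obtain ⟨y', rfl⟩ := hy
      exact ⟨x' + y', map_add _ _ _⟩
    | tmul c w =>
      induction w with
      | zero => exact ⟨0, by simp⟩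
      | add x y hx hy =>
        obtain ⟨x', hx⟩ := hx
        obtain ⟨y', hy⟩ := hy
        exact ⟨x' + y', by rw [map_add, tmul_add, hx, hy]⟩
      | tmul b ω =>
        obtain ⟨c', hc'⟩ := hjs (b • c)
        refine ⟨c' ⊗ₜ ω, ?_⟩
        change ResidueField.map (algebraMap R O) c' ⊗ₜ (1 ⊗ₜ ω) = _
        rw [hc', smul_tmul, smul_tmul', smul_eq_mul, mul_one]
  have hψs : ∀ z', Φ ((mapBaseChange k R O).lTensor (ResidueField O) (s z')) = ψ z' := by
    intro z'
    induction z' with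
    | zero => simp
    | add x y hx hy => rw [map_add, map_add, map_add, hx, hy, map_add]
    | tmul c ω =>
      have hω : ω ∈ Submodule.span R (Set.range (D k R)) := by
        rw [span_range_derivation]; trivial
      change Φ ((mapBaseChange k R O).lTensor (ResidueField O)
        (ResidueField.map (algebraMap R O) c ⊗ₜ (1 ⊗ₜ ω))) = _
      induction hω using Submodule.span_induction generalizing c with
      | mem x hx =>
        obtain ⟨r, rfl⟩ := hx
        rw [hΦ, hj, map_one, one_mul, ← Algebra.smul_def, ← map_smul, smul_tmul', smul_eq_mul,
          mul_one]
      | zero => simp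
      | add x y _ _ hx hy =>
        rw [tmul_add, tmul_add, map_add, map_add, hx, hy, tmul_add, map_add]
      | smul r x _ hx =>
        rw [tmul_smul r c x, smul_tmul', ← hx (r • c), Algebra.smul_def r c, map_mul]
        congr 2
        rw [tmul_smul, tmul_smul, smul_tmul', Algebra.smul_def]
        rfl
  rw [injective_iff_map_eq_zero]
  intro z hz
  obtain ⟨z', rfl⟩ := hs z
  rw [hψ (by rw [← hψs, hz, map_zero, map_zero] : ψ z' = ψ 0), map_zero]

theorem MvPolynomial.derivation_eq_sum_pderiv {R M σ : Type} [CommRing R] [Fintype σ]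
    [AddCommGroup M] [Module R M] [Module (MvPolynomial σ R) M]
    [IsScalarTower R (MvPolynomial σ R) M]
    (D : Derivation R (MvPolynomial σ R) M) (f : MvPolynomial σ R) :
    D f = ∑ i, pderiv i f • D (X i) := by
  classical
  let E : Derivation R (MvPolynomial σ R) M :=
    ∑ i, (LinearMap.toSpanSingleton (MvPolynomial σ R) M (D (X i))).compDer (pderiv i)
  have hE : ∀ f, E f = ∑ i, pderiv i f • D (X i) := by
    intro f
    have h : ⇑E = ∑ i, ⇑((LinearMap.toSpanSingleton (MvPolynomial σ R) M (D (X i))).compDer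
        (pderiv i)) := map_sum (Derivation.coeFnAddMonoidHom (R := R)
      (A := MvPolynomial σ R) (M := M)) _ _
    rw [h, Finset.sum_apply]
    rfl
  rw [← hE]
  congr 1
  refine MvPolynomial.derivation_ext fun i ↦ ?_
  rw [hE, Finset.sum_eq_single i (fun j _ hj ↦ by rw [pderiv_X_of_ne hj.symm, zero_smul]) (by simp),
    pderiv_X_self, one_smul]


theorem MvPolynomial.exists_mul_mem_ker_sq {F K₀ σ : Type} [Field F] [PerfectField F] [Field K₀]
    [Algebra F K₀] [Fintype σ] (ev : MvPolynomial σ F →ₐ[F] K₀)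
    (hfrac : ∀ x, ∃ r t, ev t ≠ 0 ∧ x * ev t = ev r) (f : MvPolynomial σ F) (hf : ev f = 0)
    (hfp : ∀ i, ev (pderiv i f) = 0) :
    ∃ m, ev m ≠ 0 ∧ m * f ∈ RingHom.ker ev ^ 2 := by
  let I₀ := RingHom.ker ev
  have : I₀.IsPrime := RingHom.ker_isPrime _
  let Q := Localization.AtPrime I₀
  let evQ : Q →ₐ[F] K₀ := IsLocalization.liftAlgHom (M := I₀.primeCompl) (f := ev) fun y ↦
    isUnit_iff_ne_zero.mpr y.2
  have hevQ : ∀ g, evQ (algebraMap _ Q g) = ev g := fun g ↦ IsLocalization.lift_eq _ g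
  let : Algebra Q K₀ := evQ.toAlgebra
  have : IsScalarTower F Q K₀ := .of_algebraMap_eq fun x ↦ (evQ.commutes x).symm
  have hsurjQ : Function.Surjective (algebraMap Q K₀) := by
    intro x
    obtain ⟨r, t, ht, h⟩ := hfrac x
    refine ⟨IsLocalization.mk' Q r (⟨t, ht⟩ : I₀.primeCompl), ?_⟩
    change evQ _ = _
    have h1 := congrArg evQ (IsLocalization.mk'_spec Q r (⟨t, ht⟩ : I₀.primeCompl))
    rw [map_mul, hevQ, hevQ] at h1
    apply mul_right_cancel₀ ht
    rw [h1, h]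
  have : Algebra.EssFiniteType (MvPolynomial σ F) Q := .of_isLocalization _ I₀.primeCompl
  have : Algebra.EssFiniteType F Q := .comp _ (MvPolynomial σ F) _
  have : Algebra.EssFiniteType F K₀ := .of_surjective evQ hsurjQ
  have : Algebra.FormallySmooth (MvPolynomial σ F) Q := .of_isLocalization I₀.primeCompl
  have : Algebra.FormallySmooth F Q := .comp F (MvPolynomial σ F) Q
  have hK : Algebra.FormallySmooth F K₀ := .of_perfectField
  have hinj := (Algebra.FormallySmooth.kerCotangentToTensor_injective_iff (R := F) (P := Q)
    hsurjQ).mpr hK.2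
  have hker : RingHom.ker (algebraMap Q K₀) = I₀.map (algebraMap _ Q) := by
    ext q
    obtain ⟨r, t, rfl⟩ := IsLocalization.exists_mk'_eq I₀.primeCompl q
    rw [IsLocalization.mk'_mem_map_algebraMap_iff I₀.primeCompl]
    change evQ _ = 0 ↔ _
    have h1 := congrArg evQ (IsLocalization.mk'_spec Q r t)
    rw [map_mul, hevQ, hevQ] at h1
    have ht : ev t ≠ 0 := t.2
    constructor
    · intro h
      rw [h, zero_mul] at h1
      exact ⟨1, one_mem _, by rw [one_mul]; exact h1.symm⟩
    · rintro ⟨m, hm, hmr⟩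
      have : ev r = 0 := (Ideal.IsPrime.mem_or_mem ‹_› hmr).resolve_left hm
      rw [this] at h1
      exact (mul_eq_zero.mp h1).resolve_right ht
  have hfQ : algebraMap _ Q f ∈ RingHom.ker (algebraMap Q K₀) := by
    change evQ _ = 0
    rw [hevQ]
    exact hf
  have h0 : (RingHom.ker (algebraMap Q K₀)).toCotangent ⟨_, hfQ⟩ = 0 := by
    apply hinj
    rw [kerCotangentToTensor_toCotangent, map_zero]
    change (1 : K₀) ⊗ₜ[Q] ((D F Q).compAlgebraMap (MvPolynomial σ F) f) = 0
    rw [MvPolynomial.derivation_eq_sum_pderiv, tmul_sum]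
    refine Finset.sum_eq_zero fun i _ ↦ ?_
    rw [← algebraMap_smul Q, ← smul_tmul, Algebra.smul_def]
    rw [show algebraMap Q K₀ (algebraMap _ Q (pderiv i f)) = _ from hevQ _, hfp i, zero_mul, zero_tmul]
  rw [Ideal.toCotangent_eq_zero] at h0
  change algebraMap _ Q f ∈ _ at h0
  rw [hker, ← Ideal.map_pow,
    IsLocalization.algebraMap_mem_map_algebraMap_iff I₀.primeCompl] at h0
  exact h0

theorem MvPolynomial.mem_ker_aeval_id_sq {F L : Type} [Field F] [PerfectField F] [Field L]
    [Algebra F L] (f : MvPolynomial L F) (hf : aeval (R := F) (id : L → L) f = 0)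
    (hfp : ∀ i, aeval (R := F) (id : L → L) (pderiv i f) = 0) :
    f ∈ RingHom.ker (aeval (R := F) (id : L → L)) ^ 2 := by
  obtain ⟨s, f, rfl⟩ := f.exists_finset_rename
  obtain ⟨K₀, hK₀⟩ : ∃ K₀, K₀ = IntermediateField.adjoin F (s : Set L) := ⟨_, rfl⟩
  obtain ⟨ev, hev⟩ : ∃ ev : MvPolynomial s F →ₐ[F] K₀,
      ∀ g, (ev g : L) = MvPolynomial.aeval (id : L → L) (MvPolynomial.rename (↑) g) := by
    refine ⟨MvPolynomial.aeval fun i ↦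
      ⟨i.1, hK₀ ▸ IntermediateField.subset_adjoin F _ i.2⟩, fun g ↦ ?_⟩
    rw [MvPolynomial.aeval_rename]
    exact congr($(MvPolynomial.algHom_ext (f := K₀.val.comp (MvPolynomial.aeval _))
      (g := MvPolynomial.aeval (R := F) ((id : L → L) ∘ Subtype.val)) fun i ↦ by simp) g)
  have hfrac : ∀ x, ∃ r t, ev t ≠ 0 ∧ x * ev t = ev r := by
    rintro ⟨x, hx⟩
    obtain ⟨r, t, h⟩ : ∃ r t : MvPolynomial s F,
        x = MvPolynomial.aeval Subtype.val r / MvPolynomial.aeval Subtype.val t :=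
      (IntermediateField.mem_adjoin_iff F x).mp (hK₀ ▸ hx)
    have hev' : ∀ g, (ev g : L) = MvPolynomial.aeval Subtype.val g := fun g ↦ by
      rw [hev, MvPolynomial.aeval_rename]; rfl
    by_cases ht : ev t = 0
    · refine ⟨0, 1, by simp, Subtype.ext ?_⟩
      change x * (ev 1 : L) = (ev 0 : L)
      rw [h, ← hev' t, ht]
      simp
    · refine ⟨r, t, ht, Subtype.ext ?_⟩
      change x * (ev t : L) = (ev r : L)
      rw [h, hev', hev', div_mul_cancel₀]
      rw [← hev']
      exact fun h ↦ ht (Subtype.ext h)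
  have hfp' : ∀ i, ev (MvPolynomial.pderiv i f) = 0 := fun i ↦ by
    apply Subtype.ext
    rw [hev]
    have := hfp i
    rwa [MvPolynomial.pderiv_rename Subtype.val_injective] at this
  obtain ⟨m, hm, hfm⟩ := MvPolynomial.exists_mul_mem_ker_sq ev hfrac f
    (Subtype.ext ((hev f).trans hf)) hfp'
  have hmap : ∀ g ∈ RingHom.ker ev, MvPolynomial.rename (↑) g ∈
      RingHom.ker (MvPolynomial.aeval (R := F) (id : L → L)) := by
    intro g hg
    change MvPolynomial.aeval (R := F) (id : L → L) _ = 0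
    rw [← hev, show ev g = 0 from hg]
    rfl
  have h1 : (MvPolynomial.rename (↑) (m * f) : MvPolynomial L F) ∈
      RingHom.ker (MvPolynomial.aeval (R := F) (id : L → L)) ^ 2 := by
    have := Ideal.mem_map_of_mem (MvPolynomial.rename (R := F) ((↑) : s → L)) hfm
    rw [Ideal.map_pow] at this
    exact Ideal.pow_right_mono (Ideal.map_le_iff_le_comap.mpr hmap) 2 this
  obtain ⟨n, hn⟩ : ∃ n, MvPolynomial.aeval (R := F) (id : L → L) n = (ev m : L)⁻¹ :=
    ⟨MvPolynomial.X _, MvPolynomial.aeval_X _ _⟩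
  have h2 : n * MvPolynomial.rename (↑) m - 1 ∈
      RingHom.ker (MvPolynomial.aeval (R := F) (id : L → L)) := by
    rw [RingHom.mem_ker, map_sub, map_mul, hn, map_one]
    change _ * MvPolynomial.aeval (R := F) (id : L → L) _ - 1 = 0
    rw [← hev, inv_mul_cancel₀, sub_self]
    exact fun h ↦ hm (Subtype.ext h)
  have h3 := sub_mem (Ideal.mul_mem_left _ n h1)
    (pow_two (RingHom.ker (MvPolynomial.aeval (R := F) (id : L → L))) ▸ Ideal.mul_mem_mul h2 hf)
  rw [map_mul] at h3
  convert h3 using 1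
  ring

/-- Every extension of a perfect field is formally smooth. -/
theorem formallySmooth_of_perfectField (F L : Type) [Field F] [PerfectField F] [Field L]
    [Algebra F L] : Algebra.FormallySmooth F L := by
  refine ⟨inferInstance, ?_⟩
  let P := MvPolynomial L F
  let : Algebra P L := (MvPolynomial.aeval (R := F) (id : L → L)).toAlgebra
  have : IsScalarTower F P L := .of_algebraMap_eq fun x ↦ by
    change _ = MvPolynomial.aeval (R := F) (id : L → L) (MvPolynomial.C x)
    simp
  have hsurj : Function.Surjective (algebraMap P L) := fun x ↦
    ⟨MvPolynomial.X x, MvPolynomial.aeval_X _ _⟩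
  rw [← Algebra.FormallySmooth.kerCotangentToTensor_injective_iff (R := F) (P := P) hsurj,
    injective_iff_map_eq_zero]
  intro z hz
  obtain ⟨⟨f, hf⟩, rfl⟩ := Ideal.toCotangent_surjective _ z
  rw [kerCotangentToTensor_toCotangent] at hz
  rw [Ideal.toCotangent_eq_zero]
  have hfp : ∀ i, MvPolynomial.aeval (R := F) (id : L → L) (MvPolynomial.pderiv i f) = 0 := by
    intro i
    let d : Derivation F P L := (Algebra.linearMap P L).compDer (MvPolynomial.pderiv i)
    have := congr(d.liftKaehlerDifferential.liftBaseChange L $hz)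
    rw [map_zero, LinearMap.liftBaseChange_tmul, one_smul,
      Derivation.liftKaehlerDifferential_comp_D] at this
    exact this
  exact MvPolynomial.mem_ker_aeval_id_sq f hf hfp

theorem exists_retraction_mapBaseChange (F k O : Type) [CommRing F] [CommRing k] [CommRing O]
    [Algebra F k] [Algebra k O] [Algebra F O] [IsScalarTower F k O] [Algebra.FormallySmooth k O] :
    ∃ l : Ω[O⁄F] →ₗ[O] O ⊗[k] Ω[k⁄F], l ∘ₗ mapBaseChange F k O = LinearMap.id := by
  have hinj : Function.Injective (mapBaseChange F k O) := by
    rw [injective_iff_map_eq_zero]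
    intro x hx
    obtain ⟨y, rfl⟩ := (Algebra.H1Cotangent.exact_δ_mapBaseChange F k O x).mp hx
    rw [Subsingleton.elim y 0, map_zero]
  have hex := exact_mapBaseChange_map F k O
  obtain ⟨s, hs⟩ := Module.projective_lifting_property _ LinearMap.id
    (KaehlerDifferential.map_surjective F k O)
  have hiff : (Function.Injective (mapBaseChange F k O) ∧
      ∃ s, KaehlerDifferential.map F k O O ∘ₗ s = LinearMap.id) ↔
      (Function.Surjective (KaehlerDifferential.map F k O O) ∧
        ∃ l, l ∘ₗ mapBaseChange F k O = LinearMap.id) := (Function.Exact.split_tfae' hex).out 0 1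
  exact (hiff.mp ⟨hinj, s, hs⟩).2

theorem Derivation.exists_extension {F k O M : Type} [CommRing F] [CommRing k] [CommRing O]
    [Algebra F k] [Algebra k O] [Algebra F O] [IsScalarTower F k O] [Algebra.FormallySmooth k O]
    [AddCommGroup M] [Module F M] [Module k M] [Module O M] [IsScalarTower k O M]
    [IsScalarTower F k M] [IsScalarTower F O M]
    (δ : Derivation F k M) : ∃ E : Derivation F O M, ∀ c, E (algebraMap k O c) = δ c := by
  obtain ⟨l, hl⟩ := exists_retraction_mapBaseChange F k O
  refine ⟨((δ.liftKaehlerDifferential.liftBaseChange O) ∘ₗ l).compDer (D F O), fun c ↦ ?_⟩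
  have := LinearMap.congr_fun hl (1 ⊗ₜ D F k c)
  simp only [LinearMap.comp_apply, mapBaseChange_tmul, map_D, one_smul, LinearMap.id_apply] at this
  change (δ.liftKaehlerDifferential.liftBaseChange O) (l (D F O _)) = _
  rw [this]
  simp

theorem Derivation.eq_zero_of_mem_maximalIdeal_sq {F O : Type} [CommRing F] [CommRing O]
    [IsLocalRing O] [Algebra F O] (E : Derivation F O (ResidueField O)) {x : O}
    (hx : x ∈ maximalIdeal O ^ 2) : E x = 0 := by
  rw [pow_two] at hx
  induction hx using Submodule.mul_induction_on' with
  | mem_mul_mem a ha b hb =>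
    have h : ∀ c ∈ maximalIdeal O, ∀ y : ResidueField O, c • y = 0 := fun c hc y ↦ by
      rw [Algebra.smul_def, ResidueField.algebraMap_eq, (residue_eq_zero_iff c).mpr hc, zero_mul]
    rw [E.leibniz, h a ha, h b hb, add_zero]
  | add a _ b _ ha hb => rw [map_add, ha, hb, add_zero]

theorem algebraMap_notMem_maximalIdeal_sq_of_perfectField
    (F : Type) {k R O : Type} [Field F] [PerfectField F] [Field k] [CommRing R] [CommRing O]
    [IsLocalRing R] [IsLocalRing O] [Algebra F k] [Algebra k R] [Algebra R O] [Algebra k O]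
    [IsScalarTower k R O] [Algebra.FormallySmooth k R] [Algebra.FormallySmooth k O]
    [IsLocalHom (algebraMap R O)] {g : R}
    [Algebra F R] [Algebra F O] [IsScalarTower F k R] [IsScalarTower F k O] [IsScalarTower F R O]
    (hg : g ∈ maximalIdeal R) (hg2 : g ∉ maximalIdeal R ^ 2)
    (hD : (1 ⊗ₜ D k R g : ResidueField R ⊗[R] Ω[R⁄k]) = 0) :
    algebraMap R O g ∉ maximalIdeal O ^ 2 := by
  have : Algebra.FormallySmooth F k := formallySmooth_of_perfectField F k
  have : Algebra.FormallySmooth F R := .comp F k R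
  have : Algebra.FormallySmooth F (ResidueField R) := formallySmooth_of_perfectField F _
  have hinj := (Algebra.FormallySmooth.kerCotangentToTensor_injective_iff (R := F) (P := R)
    (residue_surjective (R := R))).mpr Algebra.FormallySmooth.subsingleton_h1Cotangent
  have hker : RingHom.ker (algebraMap R (ResidueField R)) = maximalIdeal R := ker_residue
  have hgk : g ∈ RingHom.ker (algebraMap R (ResidueField R)) := hker ▸ hg
  have hne : (1 ⊗ₜ D F R g : ResidueField R ⊗[R] Ω[R⁄F]) ≠ 0 := by
    intro h
    have h0 : (RingHom.ker (algebraMap R (ResidueField R))).toCotangent ⟨g, hgk⟩ = 0 := by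
      apply hinj
      rw [kerCotangentToTensor_toCotangent, map_zero]
      exact h
    rw [Ideal.toCotangent_eq_zero] at h0
    exact hg2 (hker ▸ h0)
  obtain ⟨φ, hφ⟩ : ∃ φ : Module.Dual (ResidueField R) (ResidueField R ⊗[R] Ω[R⁄F]),
      φ (1 ⊗ₜ D F R g) ≠ 0 := by
    by_contra! h
    exact hne ((Module.forall_dual_apply_eq_zero_iff _ _).mp h)
  let d : Derivation F R (ResidueField O) :=
    ((Algebra.linearMap (ResidueField R) (ResidueField O)).restrictScalars R ∘ₗ
      φ.restrictScalars R ∘ₗ (TensorProduct.mk R _ _ 1)).compDer (D F R)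
  obtain ⟨E, hE⟩ := Derivation.exists_extension (F := F) (k := k) (O := O)
    (M := ResidueField O) (d.compAlgebraMap k)
  let G : Derivation F R (ResidueField O) := E.compAlgebraMap R - d
  have hG : ∀ r, G r = E (algebraMap R O r) - d r := fun r ↦ rfl
  have hGk : ∀ c : k, G (algebraMap k R c) = 0 := fun c ↦ by
    rw [hG, ← IsScalarTower.algebraMap_apply, hE]
    exact sub_self _
  let G' : Derivation k R (ResidueField O) := .mk'
    { toFun := G
      map_add' := map_add G
      map_smul' := fun c r ↦ by
        rw [Algebra.smul_def, G.leibniz, hGk, smul_zero, add_zero, algebraMap_smul]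
        rfl } fun a b ↦ G.leibniz a b
  have hGg : G' g = 0 := by
    have := congr(G'.liftKaehlerDifferential.liftBaseChange (ResidueField R) $hD)
    rwa [map_zero, LinearMap.liftBaseChange_tmul, one_smul,
      Derivation.liftKaehlerDifferential_comp_D] at this
  intro hmem
  have hdg : d g = 0 := by
    have h1 : E (algebraMap R O g) - d g = 0 := hGg
    rwa [E.eq_zero_of_mem_maximalIdeal_sq hmem, zero_sub, neg_eq_zero] at h1
  exact hφ ((map_eq_zero_iff (algebraMap (ResidueField R) (ResidueField O))
    (algebraMap (ResidueField R) (ResidueField O)).injective).mp hdg)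

theorem exists_perfectField_ringHom (k : Type) [Field k] :
    ∃ (F : Type) (_ : Field F) (_ : PerfectField F), Nonempty (F →+* k) := by
  obtain ⟨p, hp⟩ := CharP.exists k
  rcases CharP.char_is_prime_or_zero k p with h | rfl
  · have := Fact.mk h
    exact ⟨ZMod p, inferInstance, inferInstance, ⟨ZMod.castHom dvd_rfl k⟩⟩
  · have := CharP.charP_to_charZero k
    exact ⟨ℚ, inferInstance, inferInstance, ⟨algebraMap ℚ k⟩⟩

theorem algebraMap_notMem_maximalIdeal_sq {k R O : Type} [Field k] [CommRing R] [CommRing O]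
    [IsLocalRing R] [IsLocalRing O] [Algebra k R] [Algebra R O] [Algebra k O]
    [IsScalarTower k R O] [Algebra.FormallySmooth k R] [Algebra.FormallySmooth k O]
    [IsLocalHom (algebraMap R O)] {g : R}
    (hg : g ∈ maximalIdeal R) (hg2 : g ∉ maximalIdeal R ^ 2)
    (hD : (1 ⊗ₜ D k R g : ResidueField R ⊗[R] Ω[R⁄k]) = 0) :
    algebraMap R O g ∉ maximalIdeal O ^ 2 := by
  obtain ⟨F, _, _, ⟨i⟩⟩ := exists_perfectField_ringHom k
  let : Algebra F k := i.toAlgebra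
  let : Algebra F R := ((algebraMap k R).comp i).toAlgebra
  let : Algebra F O := ((algebraMap k O).comp i).toAlgebra
  have : IsScalarTower F k R := .of_algebraMap_eq fun _ ↦ rfl
  have : IsScalarTower F k O := .of_algebraMap_eq fun _ ↦ rfl
  have : IsScalarTower F R O := .of_algebraMap_eq fun x ↦
    IsScalarTower.algebraMap_apply k R O (i x)
  exact algebraMap_notMem_maximalIdeal_sq_of_perfectField F hg hg2 hD

theorem IsLocalRing.linearIndependent_D {F O ι : Type} [CommRing F] [CommRing O]
    [IsLocalRing O] [Algebra F O] [Algebra.FormallySmooth F O]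
    [Algebra.FormallySmooth F (ResidueField O)] (x : ι → maximalIdeal O)
    (hx : LinearIndependent (ResidueField O) fun i ↦ (maximalIdeal O).toCotangent (x i)) :
    LinearIndependent (ResidueField O)
      fun i ↦ (1 ⊗ₜ D F O (x i) : ResidueField O ⊗[O] Ω[O⁄F]) := by
  classical
  have hinj := (Algebra.FormallySmooth.kerCotangentToTensor_injective_iff (R := F) (P := O)
    (residue_surjective (R := O))).mpr Algebra.FormallySmooth.subsingleton_h1Cotangent
  have hker : RingHom.ker (algebraMap O (ResidueField O)) = maximalIdeal O := ker_residue
  rw [linearIndependent_iff'] at hx ⊢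
  intro s c hc i hi
  choose a ha using fun i ↦ residue_surjective (c i)
  have hmem : ∑ i ∈ s, a i * (x i : O) ∈ maximalIdeal O :=
    sum_mem fun i _ ↦ Ideal.mul_mem_left _ _ (x i).2
  have hmem' : ∑ i ∈ s, a i * (x i : O) ∈ RingHom.ker (algebraMap O (ResidueField O)) :=
    (by rw [hker]; exact hmem)
  have h0 : (RingHom.ker (algebraMap O (ResidueField O))).toCotangent ⟨_, hmem'⟩ = 0 := by
    apply hinj
    rw [kerCotangentToTensor_toCotangent, map_zero]
    change 1 ⊗ₜ D F O (∑ i ∈ s, a i * (x i : O)) = 0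
    rw [map_sum, tmul_sum, ← hc]
    refine Finset.sum_congr rfl fun i _ ↦ ?_
    rw [Derivation.leibniz, tmul_add, ← smul_tmul, ← smul_tmul, Algebra.smul_def (x i : O),
      ResidueField.algebraMap_eq, (residue_eq_zero_iff _).mpr (x i).2, zero_mul, zero_tmul,
      add_zero, ← ha, smul_tmul', Algebra.smul_def, smul_eq_mul]
    rfl
  rw [Ideal.toCotangent_eq_zero] at h0
  replace h0 : ∑ i ∈ s, a i * (x i : O) ∈ maximalIdeal O ^ 2 :=
    (SetLike.ext_iff.mp (congrArg (fun I : Ideal O ↦ I ^ 2) hker) _).mp h0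
  refine hx s c ?_ i hi
  rw [← (Ideal.toCotangent_eq_zero _ ⟨_, hmem⟩).mpr h0]
  rw [show (⟨_, hmem⟩ : maximalIdeal O) = ∑ i ∈ s, a i • x i from Subtype.ext (by
    simp), map_sum]
  refine Finset.sum_congr rfl fun i _ ↦ ?_
  rw [map_smul, ← ha]
  exact algebraMap_smul (ResidueField O) (a i) _

open PowerSeries in
theorem PowerSeries.injective_of_generic_arc {O L : Type} [CommRing O] [IsLocalRing O]
    [IsNoetherianRing O] [Field L] [Algebra (ResidueField O) L] {ι : Type} [Fintype ι] (x : ι → O)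
    (hx : Ideal.span (Set.range x) = maximalIdeal O) (lam : ι → L)
    (hlam : AlgebraicIndependent (ResidueField O) lam) (α : O →+* PowerSeries L)
    (hα0 : ∀ r, constantCoeff (α r) = algebraMap (ResidueField O) L (residue O r))
    (hα1 : ∀ i, coeff 1 (α (x i)) = lam i) : Function.Injective α := by
  have hu : ∀ i, ∃ u : PowerSeries L, α (x i) = X * u ∧ constantCoeff u = lam i := by
    intro i
    obtain ⟨u, hu⟩ := X_dvd_iff.mpr (show constantCoeff (α (x i)) = 0 by
      rw [hα0, (residue_eq_zero_iff _).mpr (hx ▸ Ideal.subset_span ⟨i, rfl⟩), map_zero])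
    refine ⟨u, hu, ?_⟩
    rw [← hα1, hu, ← zero_add 1, coeff_succ_X_mul, coeff_zero_eq_constantCoeff_apply]
  choose u hu hu0 using hu
  rw [injective_iff_map_eq_zero]
  intro a ha
  suffices ∀ n, a ∈ maximalIdeal O ^ n by
    have h := Ideal.iInf_pow_eq_bot_of_isLocalRing (maximalIdeal O) (Ideal.IsPrime.ne_top')
    rw [← Ideal.mem_bot, ← h, Ideal.mem_iInf]
    exact this
  intro n
  induction n with
  | zero => simp
  | succ n ih =>
    rw [← hx, Ideal.mem_span_pow_iff_exists_isHomogeneous] at ih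
    obtain ⟨p, hp, rfl⟩ := ih
    have hdeg : ∀ d ∈ p.support, ∑ i, d i = n := fun d hd ↦ by
      rw [← Finsupp.degree_eq_sum, Finsupp.degree_eq_weight_one]
      exact hp (MvPolynomial.mem_support_iff.mp hd)
    have h1 : MvPolynomial.eval₂ α u p = 0 := by
      have h2 : α (MvPolynomial.eval x p) = X ^ n * MvPolynomial.eval₂ α u p := by
        rw [MvPolynomial.eval, MvPolynomial.coe_eval₂Hom, MvPolynomial.eval₂_eq',
          MvPolynomial.eval₂_eq', map_sum, Finset.mul_sum]
        refine Finset.sum_congr rfl fun d hd ↦ ?_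
        simp only [map_mul, map_prod, map_pow, hu, mul_pow, Finset.prod_mul_distrib,
          Finset.prod_pow_eq_pow_sum, hdeg d hd, RingHom.id_apply]
        ring
      rw [h2] at ha
      exact (mul_eq_zero.mp ha).resolve_left (pow_ne_zero _ X_ne_zero)
    have h2 : MvPolynomial.aeval lam (p.map (residue O)) = 0 := by
      rw [MvPolynomial.aeval_def, MvPolynomial.eval₂_map]
      have := congrArg constantCoeff h1
      rw [MvPolynomial.hom_eval₂, map_zero] at this
      rw [← this]
      congr 1
      · ext r; exact (hα0 r).symm
      · ext i; exact (hu0 i).symm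
    have h3 : p.map (residue O) = 0 := hlam (by rw [h2, map_zero])
    rw [MvPolynomial.eval_eq']
    refine sum_mem fun d hd ↦ ?_
    rw [pow_succ']
    refine Ideal.mul_mem_mul ?_ ?_
    · rw [← residue_eq_zero_iff, ← MvPolynomial.coeff_map, h3, MvPolynomial.coeff_zero]
    · rw [← hdeg d hd, ← Finset.prod_pow_eq_pow_sum]
      exact Ideal.prod_mem_prod fun i _ ↦ Ideal.pow_mem_pow (hx ▸ Ideal.subset_span ⟨i, rfl⟩) _

theorem isDomain_of_formallySmooth_perfectField (F O : Type) [Field F] [PerfectField F]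
    [CommRing O] [IsLocalRing O] [IsNoetherianRing O] [Algebra F O] [Algebra.FormallySmooth F O] :
    IsDomain O := by
  have : Algebra.FormallySmooth F (ResidueField O) := formallySmooth_of_perfectField F _
  let b := Module.finBasis (ResidueField O) (CotangentSpace O)
  choose x hx using fun i ↦ Ideal.toCotangent_surjective _ (b i)
  have hli := IsLocalRing.linearIndependent_D (F := F) x
    (by convert b.linearIndependent using 1; exact funext hx)
  have hspan : Ideal.span (Set.range fun i ↦ (x i : O)) = maximalIdeal O := by
    have h1 : Submodule.span O (Set.range x) = ⊤ := by
      rw [← CotangentSpace.span_image_eq_top_iff, ← Set.range_comp,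
        show (maximalIdeal O).toCotangent ∘ x = b from funext hx, b.span_eq]
    have h2 := congrArg (Submodule.map (maximalIdeal O).subtype) h1
    rw [Submodule.map_span, ← Set.range_comp, Submodule.map_top, Submodule.range_subtype] at h2
    exact h2
  let ι := Fin (Module.finrank (ResidueField O) (CotangentSpace O))
  let L := FractionRing (MvPolynomial ι (ResidueField O))
  let lam : ι → L := fun i ↦ algebraMap (MvPolynomial ι (ResidueField O)) L (MvPolynomial.X i)
  have hlam : AlgebraicIndependent (ResidueField O) lam :=
    (MvPolynomial.algebraicIndependent_X _ _).map' (f := IsScalarTower.toAlgHom _ _ L)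
      (IsFractionRing.injective _ _)
  obtain ⟨Φ, hΦ⟩ : ∃ Φ : ResidueField O ⊗[O] Ω[O⁄F] →ₗ[ResidueField O] L,
      ∀ i, Φ (1 ⊗ₜ D F O (x i)) = lam i := by
    obtain ⟨Φ, hΦ⟩ := ((Module.Basis.span hli).constr ℕ lam).exists_extend
    refine ⟨Φ, fun i ↦ ?_⟩
    have := LinearMap.congr_fun hΦ (Module.Basis.span hli i)
    rw [Module.Basis.constr_basis] at this
    rw [← this, LinearMap.comp_apply, Submodule.subtype_apply, Module.Basis.span_apply]
  obtain ⟨α, hα0, hα1⟩ := exists_arc (k := F) (R := O) (L := L)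
    ((Φ.restrictScalars O ∘ₗ TensorProduct.mk O _ _ 1).compDer (D F O))
  have hinj := PowerSeries.injective_of_generic_arc (fun i ↦ (x i : O)) hspan lam hlam α.toRingHom
    (fun r ↦ (hα0 r).trans (IsScalarTower.algebraMap_apply O (ResidueField O) L r))
    fun i ↦ (hα1 _).trans (hΦ i)
  exact hinj.isDomain α.toRingHom

theorem formallySmooth_quotient_span_singleton {F O : Type} [CommRing F]
    [CommRing O] [IsLocalRing O] [Algebra F O] [Algebra.FormallySmooth F O] {g : O}
    (hg : (1 ⊗ₜ D F O g : ResidueField O ⊗[O] Ω[O⁄F]) ≠ 0) :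
    Algebra.FormallySmooth F (O ⧸ Ideal.span {g}) := by
  obtain ⟨c, hc⟩ : ∃ c : Ω[O⁄F] →ₗ[O] O, c (D F O g) = 1 := by
    obtain ⟨s, hs⟩ := Module.Projective.out (R := O) (P := Ω[O⁄F])
    obtain ⟨i, hi⟩ : ∃ i, IsUnit (s (D F O g) i) := by
      by_contra! h
      apply hg
      rw [← hs (D F O g), Finsupp.linearCombination_apply, Finsupp.sum, tmul_sum]
      refine Finset.sum_eq_zero fun i _ ↦ ?_
      rw [← smul_tmul, Algebra.smul_def, ResidueField.algebraMap_eq,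
        (residue_eq_zero_iff _).mpr ((mem_maximalIdeal _).mpr (h i)), zero_mul, zero_tmul]
    obtain ⟨v, hv⟩ := hi.exists_left_inv
    exact ⟨v • (Finsupp.lapply i ∘ₗ s), hv⟩
  have hker : RingHom.ker (algebraMap O (O ⧸ Ideal.span {g})) = Ideal.span {g} := Ideal.mk_ker
  have hgk : g ∈ RingHom.ker (algebraMap O (O ⧸ Ideal.span {g})) := by
    rw [hker]; exact Ideal.subset_span rfl
  rw [Algebra.FormallySmooth.iff_split_injection (P := O) Ideal.Quotient.mk_surjective]
  let t := (RingHom.ker (algebraMap O (O ⧸ Ideal.span {g}))).toCotangent ⟨g, hgk⟩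
  let q : (O ⧸ Ideal.span {g}) →ₗ[O] (RingHom.ker (algebraMap O (O ⧸ Ideal.span {g}))).Cotangent :=
    Submodule.liftQ _ (LinearMap.toSpanSingleton O _ t) (by
      rw [Ideal.span_singleton_le_iff_mem]
      change g • t = 0
      rw [← map_smul, Ideal.toCotangent_eq_zero, pow_two]
      exact Ideal.mul_mem_mul hgk hgk)
  refine ⟨q ∘ₗ (TensorProduct.rid O _).toLinearMap ∘ₗ c.lTensor _, ?_⟩
  ext z
  obtain ⟨⟨y, hy⟩, rfl⟩ := Ideal.toCotangent_surjective _ z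
  obtain ⟨a, rfl⟩ := Ideal.mem_span_singleton'.mp (hker ▸ hy)
  have : (RingHom.ker (algebraMap O (O ⧸ Ideal.span {g}))).toCotangent ⟨a * g, hy⟩ = a • t := by
    rw [← map_smul]; rfl
  rw [this, map_smul, map_smul]
  congr 1
  rw [LinearMap.comp_apply, kerCotangentToTensor_toCotangent]
  change q (TensorProduct.rid O _ (1 ⊗ₜ c (D F O g))) = t
  rw [hc, TensorProduct.rid_tmul, one_smul]
  change (1 : O) • t = t
  rw [one_smul]

theorem isPrime_span_singleton_of_perfectField (F : Type) {O : Type} [Field F] [PerfectField F]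
    [CommRing O] [IsLocalRing O] [IsNoetherianRing O] [Algebra F O] [Algebra.FormallySmooth F O]
    {g : O} (hg : g ∈ maximalIdeal O) (hg2 : g ∉ maximalIdeal O ^ 2) :
    (Ideal.span {g}).IsPrime := by
  have : Algebra.FormallySmooth F (ResidueField O) := formallySmooth_of_perfectField F _
  have h := IsLocalRing.linearIndependent_D (F := F) (fun _ : Unit ↦ (⟨g, hg⟩ : maximalIdeal O))
    (by
      rw [linearIndependent_unique_iff]
      rwa [Ne, Ideal.toCotangent_eq_zero])
  rw [linearIndependent_unique_iff] at h
  have := formallySmooth_quotient_span_singleton h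
  have : Nontrivial (O ⧸ Ideal.span {g}) := Ideal.Quotient.nontrivial_iff.mpr fun h ↦
    (maximalIdeal.isMaximal O).ne_top (top_unique (h ▸ (Ideal.span_singleton_le_iff_mem _).mpr hg))
  have : IsLocalRing (O ⧸ Ideal.span {g}) := .of_surjective' (Ideal.Quotient.mk _)
    Ideal.Quotient.mk_surjective
  have := isDomain_of_formallySmooth_perfectField F (O ⧸ Ideal.span {g})
  exact (Ideal.Quotient.isDomain_iff_prime _).mp this

theorem exists_formallySmooth_perfectField {k O : Type} [Field k] [CommRing O] [Algebra k O]
    [Algebra.FormallySmooth k O] : ∃ (F : Type) (_ : Field F) (_ : PerfectField F)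
      (_ : Algebra F O), Algebra.FormallySmooth F O := by
  obtain ⟨F, _, _, ⟨i⟩⟩ := exists_perfectField_ringHom k
  let : Algebra F k := i.toAlgebra
  let : Algebra F O := ((algebraMap k O).comp i).toAlgebra
  have : IsScalarTower F k O := .of_algebraMap_eq fun _ ↦ rfl
  have : Algebra.FormallySmooth F k := formallySmooth_of_perfectField F k
  exact ⟨F, _, ‹_›, _, .comp F k O⟩

theorem isDomain_of_formallySmooth_field (k O : Type) [Field k] [CommRing O] [IsLocalRing O]
    [IsNoetherianRing O] [Algebra k O] [Algebra.FormallySmooth k O] : IsDomain O := by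
  obtain ⟨F, _, _, _, _⟩ := exists_formallySmooth_perfectField (k := k) (O := O)
  exact isDomain_of_formallySmooth_perfectField F O

theorem isPrime_span_singleton (k : Type) {O : Type} [Field k] [CommRing O] [IsLocalRing O]
    [IsNoetherianRing O] [Algebra k O] [Algebra.FormallySmooth k O]
    {g : O} (hg : g ∈ maximalIdeal O) (hg2 : g ∉ maximalIdeal O ^ 2) :
    (Ideal.span {g}).IsPrime := by
  obtain ⟨F, _, _, _, _⟩ := exists_formallySmooth_perfectField (k := k) (O := O)
  exact isPrime_span_singleton_of_perfectField F hg hg2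

theorem LinearMap.exists_det {O M N : Type} [CommRing O] [Nontrivial O] [AddCommGroup M]
    [AddCommGroup N] [Module O M] [Module O N] [Module.Free O M] [Module.Free O N]
    [Module.Finite O M] [Module.Finite O N] (h : Module.finrank O M = Module.finrank O N)
    (φ : M →ₗ[O] N) : ∃ J : O, (IsUnit J → Function.Bijective φ) ∧
      ∀ (A : Type) [CommRing A] [Algebra O A], Function.Surjective (φ.lTensor A) →
        IsUnit (algebraMap O A J) := by
  let e : N ≃ₗ[O] M := LinearEquiv.ofFinrankEq N M h.symm
  refine ⟨LinearMap.det (e.toLinearMap ∘ₗ φ), fun hJ ↦ ?_, fun A _ _ hs ↦ ?_⟩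
  · rw [← LinearMap.isUnit_iff_isUnit_det, Module.End.isUnit_iff] at hJ
    rw [LinearMap.coe_comp] at hJ
    exact (Function.Bijective.of_comp_iff' e.bijective φ).mp hJ
  · rw [← LinearMap.det_baseChange, ← LinearMap.isUnit_iff_isUnit_det, Module.End.isUnit_iff]
    have : Function.Surjective ((e.toLinearMap ∘ₗ φ).baseChange A) := by
      change Function.Surjective ((e.toLinearMap ∘ₗ φ).lTensor A)
      rw [LinearMap.lTensor_comp]
      exact (LinearMap.lTensor_surjective A e.surjective).comp hs
    exact OrzechProperty.bijective_of_surjective_endomorphism _ this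

theorem Algebra.IsEpi.surjective_algebraMap_of_field {K A : Type} [Field K] [CommRing A]
    [Nontrivial A] [Algebra K A] [Algebra.IsEpi K A] : Function.Surjective (algebraMap K A) := by
  intro a
  by_contra! h
  obtain ⟨f, hf, hf1⟩ := Submodule.exists_le_ker_of_notMem (p := Submodule.span K {(1 : A)})
    (v := a) (by
      rw [Submodule.mem_span_singleton]
      rintro ⟨c, hc⟩
      exact h c (by rw [Algebra.algebraMap_eq_smul_one, hc]))
  have h1 := congrArg (_root_.TensorProduct.lift ((LinearMap.lsmul K A).comp f))
    ((Algebra.isEpi_iff_forall_one_tmul_eq K A).mp inferInstance a)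
  have h2 : f 1 = 0 := hf1 (Submodule.subset_span rfl)
  simp only [lift.tmul, LinearMap.comp_apply, LinearMap.lsmul_apply, h2, zero_smul] at h1
  exact smul_ne_zero hf (one_ne_zero (α := A)) (by simpa using h1.symm)

theorem Algebra.IsEpi.of_tower (R A B : Type) [CommRing R] [CommRing A] [CommRing B] [Algebra R A]
    [Algebra A B] [Algebra R B] [IsScalarTower R A B] [Algebra.IsEpi R B] : Algebra.IsEpi A B := by
  rw [Algebra.isEpi_iff_forall_one_tmul_eq]
  intro a
  have h1 := congrArg (_root_.TensorProduct.lift ((TensorProduct.mk A B B).restrictScalars₁₂ R R))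
    ((Algebra.isEpi_iff_forall_one_tmul_eq R B).mp inferInstance a)
  simpa using h1

theorem Algebra.IsEpi.subsingleton_kaehlerDifferential {R A : Type} [CommRing R] [CommRing A]
    [Algebra R A] [Algebra.IsEpi R A] : Subsingleton (Ω[A⁄R]) := by
  refine ⟨fun x y ↦ ?_⟩
  have hD : ∀ a, D R A a = 0 := by
    intro a
    have h1 := (Algebra.isEpi_iff_forall_one_tmul_eq R A).mp inferInstance a
    change (KaehlerDifferential.ideal R A).toCotangent _ = 0
    rw [← map_zero (KaehlerDifferential.ideal R A).toCotangent]
    congr 1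
    exact Subtype.ext (sub_eq_zero.mpr h1)
  have h : (⊤ : Submodule A Ω[A⁄R]) = ⊥ := by
    rw [← span_range_derivation, Submodule.span_eq_bot]
    rintro _ ⟨a, rfl⟩
    exact hD a
  have h2 : ∀ z : Ω[A⁄R], z = 0 := fun z ↦ (Submodule.mem_bot A).mp (h ▸ Submodule.mem_top)
  rw [h2 x, h2 y]

theorem finrank_kaehlerDifferential_eq_fractionRing (k O K : Type) [Field k] [CommRing O]
    [IsLocalRing O] [IsDomain O]
    [Algebra k O] [Module.Finite O Ω[O⁄k]] [Algebra.FormallySmooth k O] [Field K] [Algebra O K]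
    [IsFractionRing O K] [Algebra k K] [IsScalarTower k O K] :
    Module.finrank O Ω[O⁄k] = Module.finrank K Ω[K⁄k] := by
  have : Algebra.FormallyEtale O K := .of_isLocalization (nonZeroDivisors O)
  have : Module.Free O Ω[O⁄k] := Module.free_of_flat_of_isLocalRing
  rw [← (tensorKaehlerEquivOfFormallyEtale k O K).finrank_eq, Module.finrank_baseChange]

theorem isFractionRing_of_isEpi {R K : Type} [CommRing R] [IsDomain R] [Field K] [Algebra R K]
    [Algebra.IsEpi R K] (h : Function.Injective (algebraMap R K)) : IsFractionRing R K := by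
  have : FaithfulSMul R K := (faithfulSMul_iff_algebraMap_injective R K).mpr h
  let : Algebra (FractionRing R) K := FractionRing.liftAlgebra R K
  have : Algebra.IsEpi (FractionRing R) K := .of_tower R _ _
  have hs := Algebra.IsEpi.surjective_algebraMap_of_field (K := FractionRing R) (A := K)
  let e : FractionRing R ≃ₐ[R] K := AlgEquiv.ofBijective (IsScalarTower.toAlgHom R _ _)
    ⟨(algebraMap (FractionRing R) K).injective, hs⟩
  exact IsLocalization.isLocalization_of_algEquiv _ e

theorem finrank_kaehlerDifferential_eq (k : Type) {R O : Type} [Field k] [CommRing R]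
    [IsLocalRing R] [IsDomain R]
    [CommRing O] [IsDomain O] [IsLocalRing O] [Algebra k R] [Algebra R O] [Algebra k O]
    [IsScalarTower k R O]
    [Algebra.FormallySmooth k R] [Algebra.FormallySmooth k O] [Module.Finite R Ω[R⁄k]]
    [Module.Finite O Ω[O⁄k]] (hinj : Function.Injective (algebraMap R O))
    (hepi : Algebra.IsEpi R (FractionRing O)) :
    Module.finrank R Ω[R⁄k] = Module.finrank O Ω[O⁄k] := by
  let K := FractionRing O
  have : IsScalarTower k R K := .to₁₂₄ k R O K
  have : IsFractionRing R K := isFractionRing_of_isEpi (by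
    rw [IsScalarTower.algebraMap_eq R O K]
    exact (IsFractionRing.injective O K).comp hinj)
  rw [finrank_kaehlerDifferential_eq_fractionRing k R K,
    finrank_kaehlerDifferential_eq_fractionRing k O K]

theorem Algebra.IsEpi.of_algEquiv {R A B : Type} [CommRing R] [CommRing A] [CommRing B]
    [Algebra R A] [Algebra R B] [Algebra.IsEpi R A] (e : A ≃ₐ[R] B) : Algebra.IsEpi R B := by
  rw [Algebra.isEpi_iff_forall_one_tmul_eq]
  intro b
  simpa using congrArg (Algebra.TensorProduct.map e.toAlgHom e.toAlgHom)
    ((Algebra.isEpi_iff_forall_one_tmul_eq R A).mp inferInstance (e.symm b))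

theorem isEpi_fractionRing (R O : Type) [CommRing R] [CommRing O] [IsDomain O] [Algebra R O]
    [Algebra.IsEpi R (Localization.AtPrime (⊥ : Ideal O))] :
    Algebra.IsEpi R (FractionRing O) := by
  have hM : (⊥ : Ideal O).primeCompl = nonZeroDivisors O := by
    ext x
    simp [Ideal.mem_primeCompl_iff]
  have : IsLocalization (⊥ : Ideal O).primeCompl (FractionRing O) := by
    rw [hM]
    exact Localization.isLocalization
  exact .of_algEquiv ((IsLocalization.algEquiv (⊥ : Ideal O).primeCompl
    (Localization.AtPrime (⊥ : Ideal O)) (FractionRing O)).restrictScalars R)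

theorem formallySmooth_of_height_one (k : Type) {R O : Type} [Field k] [CommRing R]
    [IsLocalRing R] [IsNoetherianRing R]
    [CommRing O] [IsNoetherianRing O] [IsLocalRing O] [Algebra k R] [Algebra R O] [Algebra k O]
    [IsScalarTower k R O]
    [Algebra.FormallySmooth k R] [Algebra.FormallySmooth k O] [Module.Finite R Ω[R⁄k]]
    [Module.Finite O Ω[O⁄k]] [IsLocalHom (algebraMap R O)]
    (hinj : Function.Injective (algebraMap R O))
    (hgen : ∀ (P : Ideal O) [P.IsPrime], P.comap (algebraMap R O) ≠ maximalIdeal R →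
      Algebra.IsEpi R (Localization.AtPrime P))
    {g : R} (hg : g ∈ maximalIdeal R) (hg2 : g ∉ maximalIdeal R ^ 2)
    (hD : (1 ⊗ₜ D k R g : ResidueField R ⊗[R] Ω[R⁄k]) = 0)
    (P' : Ideal O) [P'.IsPrime] (hgP : algebraMap R O g ∈ P')
    (hP' : P'.comap (algebraMap R O) ≠ maximalIdeal R) : Algebra.FormallySmooth R O := by
  have := isDomain_of_formallySmooth_field k R
  have := isDomain_of_formallySmooth_field k O
  have hgO := algebraMap_notMem_maximalIdeal_sq (O := O) hg hg2 hD
  have hprime := isPrime_span_singleton k (O := O)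
    (((local_hom_TFAE (algebraMap R O)).out 0 2 :).mp inferInstance (Ideal.mem_map_of_mem _ hg)) hgO
  have hbot : (⊥ : Ideal O).comap (algebraMap R O) ≠ maximalIdeal R := by
    intro h
    rw [← h, Ideal.mem_comap, Ideal.mem_bot] at hg
    exact hgO (hg ▸ zero_mem _)
  have := hgen ⊥ hbot
  have hepi := isEpi_fractionRing R O
  have : Module.Free R Ω[R⁄k] := Module.free_of_flat_of_isLocalRing
  have : Module.Free O Ω[O⁄k] := Module.free_of_flat_of_isLocalRing
  obtain ⟨J, hJ1, hJ2⟩ := LinearMap.exists_det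
    ((Module.finrank_baseChange).trans (finrank_kaehlerDifferential_eq k hinj hepi))
    (mapBaseChange k R O)
  have hJ : ∀ (P : Ideal O) [P.IsPrime], P.comap (algebraMap R O) ≠ maximalIdeal R → J ∉ P := by
    intro P _ hP hJP
    have := hgen P hP
    have hu := hJ2 (Localization.AtPrime P) (by
      have hex := lTensor_exact (Localization.AtPrime P) (exact_mapBaseChange_map k R O)
        (KaehlerDifferential.map_surjective k R O)
      have : Subsingleton (Localization.AtPrime P ⊗[O] Ω[O⁄R]) := by
        have : Algebra.FormallyEtale O (Localization.AtPrime P) :=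
          .of_isLocalization P.primeCompl
        have := Algebra.IsEpi.subsingleton_kaehlerDifferential (R := R)
          (A := Localization.AtPrime P)
        exact (tensorKaehlerEquivOfFormallyEtale R O (Localization.AtPrime P)).subsingleton
      exact fun x ↦ (hex x).mp (Subsingleton.elim _ _))
    exact (IsLocalization.AtPrime.isUnit_to_map_iff (Localization.AtPrime P) P J).mp hu hJP
  by_cases hu : IsUnit J
  · let e := LinearEquiv.ofBijective _ (hJ1 hu)
    exact formallySmooth_of_split e.symm.toLinearMap (LinearMap.ext e.symm_apply_apply)
  exfalso
  obtain ⟨P, hP⟩ := Ideal.nonempty_minimalPrimes (I := Ideal.span {J})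
    (by rwa [Ne, Ideal.span_singleton_eq_top])
  have := hP.1.1
  have hJP : J ∈ P := hP.1.2 (Ideal.mem_span_singleton_self J)
  have hcomap : P.comap (algebraMap R O) = maximalIdeal R := by
    by_contra h
    exact hJ P h hJP
  have hgP1 : Ideal.span {algebraMap R O g} ≤ P := by
    rw [Ideal.span_singleton_le_iff_mem, ← Ideal.mem_comap, hcomap]
    exact hg
  have hht := Ideal.height_le_one_of_isPrincipal_of_mem_minimalPrimes (Ideal.span {J}) P hP
  have heq : Ideal.span {algebraMap R O g} = P := by
    by_contra h
    have h1 := hgP1.lt_of_ne h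
    have h2 : ⊥ < Ideal.span {algebraMap R O g} := by
      rw [bot_lt_iff_ne_bot, Ne, Ideal.span_singleton_eq_bot]
      intro h0
      exact hgO (h0 ▸ zero_mem _)
    have h3 := Ideal.height_add_one_le_of_lt_of_isPrime h1
    have h4 := Ideal.height_add_one_le_of_lt_of_isPrime h2
    have h5 := ((add_le_add_left (le_add_self.trans h4) 1).trans h3).trans hht
    exact absurd h5 (by decide)
  refine hJ P' hP' ?_
  rw [← heq] at hJP
  exact (Ideal.span_singleton_le_iff_mem _).mpr hgP hJP

end

section

open Polynomial

theorem isPrincipalIdealRing_of_isLocalization {R : Type*} [CommRing R] [IsPrincipalIdealRing R]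
    (M : Submonoid R) (O : Type*) [CommRing O] [Algebra R O] [IsLocalization M O] :
    IsPrincipalIdealRing O where
  principal I := by
    obtain ⟨g, hg⟩ := IsPrincipalIdealRing.principal (I.under R)
    refine ⟨algebraMap R O g, ?_⟩
    rw [← IsLocalization.map_under M O I, hg]
    simp [Ideal.submodule_span_eq, Ideal.map_span]

theorem valuationRing_of_isLocalization_polynomial (A κ : Type) {O : Type} [CommRing A]
    [IsDomain A] [Field κ] [Algebra A κ] [IsFractionRing A κ] [CommRing O] [IsDomain O] [Algebra A[X] O]
    (p : Ideal A[X]) [p.IsPrime]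
    [IsLocalization.AtPrime O p] (hp : ∀ a, C a ∈ p → a = 0) : ValuationRing O := by
  let : Algebra A[X] κ[X] := Polynomial.algebra A κ
  let M : Submonoid A[X] := (nonZeroDivisors A).map C
  have : IsLocalization M κ[X] := Polynomial.isLocalization (nonZeroDivisors A) κ
  have hM : M ≤ p.primeCompl := by
    rintro _ ⟨a, ha, rfl⟩ h
    exact nonZeroDivisors.ne_zero ha (hp a h)
  let : Algebra κ[X] O := IsLocalization.localizationAlgebraOfSubmonoidLe κ[X] O M p.primeCompl hM
  have : IsScalarTower A[X] κ[X] O :=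
    IsLocalization.localization_isScalarTower_of_submonoid_le κ[X] O M p.primeCompl hM
  have : IsLocalization _ O :=
    IsLocalization.isLocalization_of_submonoid_le κ[X] O M p.primeCompl hM
  have : IsPrincipalIdealRing O := isPrincipalIdealRing_of_isLocalization
    (p.primeCompl.map (algebraMap A[X] κ[X])) O
  have : IsLocalRing O := IsLocalization.AtPrime.isLocalRing O p
  infer_instance

theorem exists_away_isFractionRing (k : Type) {A κ : Type} [CommRing k] [CommRing A] [IsDomain A]
    [Field κ] [Algebra k A] [Algebra k κ] [Algebra A κ] [IsScalarTower k A κ] [IsFractionRing A κ]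
    {s : A} (hs : s ≠ 0) :
    ∃ (_ : Algebra (Localization.Away s) κ), IsScalarTower A (Localization.Away s) κ ∧
      IsScalarTower k (Localization.Away s) κ ∧ IsFractionRing (Localization.Away s) κ ∧
      IsDomain (Localization.Away s) := by
  let φ : Localization.Away s →+* κ := IsLocalization.Away.lift (g := algebraMap A κ) s
    (IsUnit.mk0 _ ((map_ne_zero_iff _ (IsFractionRing.injective A κ)).mpr hs))
  let := φ.toAlgebra
  have h1 : IsScalarTower A (Localization.Away s) κ := .of_algebraMap_eq fun x ↦
    (IsLocalization.Away.lift_eq s _ x).symm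
  have h2 : IsScalarTower k (Localization.Away s) κ := .of_algebraMap_eq fun x ↦ by
    rw [IsScalarTower.algebraMap_apply k A κ, IsScalarTower.algebraMap_apply k A (Localization.Away s),
      ← IsScalarTower.algebraMap_apply A (Localization.Away s) κ]
  exact ⟨_, h1, h2, IsFractionRing.isFractionRing_of_isDomain_of_isLocalization
    (Submonoid.powers s) (Localization.Away s) κ, IsLocalization.isDomain_of_le_nonZeroDivisors
    (M := Submonoid.powers s) _ (powers_le_nonZeroDivisors_of_noZeroDivisors hs)⟩

theorem exists_smooth_isFractionRing (k κ : Type) [Field k] [Field κ] [Algebra k κ]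
    [Algebra.EssFiniteType k κ] [Algebra.FormallySmooth k κ] :
    ∃ (A : Type) (_ : CommRing A) (_ : Algebra k A) (_ : Algebra A κ), IsScalarTower k A κ ∧
      IsFractionRing A κ ∧ Algebra.Smooth k A := by
  let A₀ := Algebra.EssFiniteType.subalgebra k κ
  have : IsFractionRing A₀ κ := by
    have h := Algebra.EssFiniteType.isLocalization k κ
    refine IsFractionRing.of_field _ _ fun z ↦ ?_
    obtain ⟨⟨x, y⟩, h⟩ := IsLocalization.surj (Algebra.EssFiniteType.submonoid k κ) z
    have hy : algebraMap A₀ κ y ≠ 0 := (IsLocalization.map_units κ y).ne_zero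
    exact ⟨x, y, by rw [eq_div_iff hy]; exact h⟩
  have : Algebra.FinitePresentation k A₀ := Algebra.FinitePresentation.of_finiteType.mp inferInstance
  have hM : (⊥ : Ideal A₀).primeCompl = nonZeroDivisors A₀ := by
    ext x
    simp [Ideal.mem_primeCompl_iff]
  have : IsLocalization (⊥ : Ideal A₀).primeCompl κ := by
    rw [hM]
    infer_instance
  have : Algebra.IsSmoothAt k (⊥ : Ideal A₀) := Algebra.FormallySmooth.of_equiv
    ((IsLocalization.algEquiv (⊥ : Ideal A₀).primeCompl κ
      (Localization.AtPrime (⊥ : Ideal A₀))).restrictScalars k)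
  obtain ⟨s, hs, h⟩ := Algebra.IsSmoothAt.exists_notMem_smooth k (⊥ : Ideal A₀)
  obtain ⟨i, -, h1, h2, -⟩ := exists_away_isFractionRing k (κ := κ) (s := s) hs
  exact ⟨_, _, _, i, h1, h2, h⟩

end

section

open IsLocalRing KaehlerDifferential TensorProduct PowerSeries

theorem exists_D_ne_zero {k R : Type} [CommRing k] [CommRing R] [IsLocalRing R]
    [IsNoetherianRing R] [Algebra k R] [Algebra.FormallySmooth k R]
    [Algebra.FormallySmooth k (ResidueField R)] (hR : ¬ IsField R) :
    ∃ a ∈ maximalIdeal R, (1 ⊗ₜ D k R a : ResidueField R ⊗[R] Ω[R⁄k]) ≠ 0 := by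
  by_contra! H
  have hinj := (Algebra.FormallySmooth.kerCotangentToTensor_injective_iff (R := k) (P := R)
    (A := ResidueField R) residue_surjective).mpr inferInstance
  have hker : RingHom.ker (algebraMap R (ResidueField R)) = maximalIdeal R := ker_residue
  refine hR (isField_iff_maximalIdeal_eq.mpr ?_)
  refine Submodule.eq_bot_of_le_smul_of_le_jacobson_bot (maximalIdeal R) (maximalIdeal R)
    (IsNoetherian.noetherian _) (fun a ha ↦ ?_) (maximalIdeal_le_jacobson ⊥)
  rw [smul_eq_mul, ← pow_two]
  have : Ideal.toCotangent (RingHom.ker (algebraMap R (ResidueField R))) ⟨a, hker ▸ ha⟩ = 0 := by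
    apply hinj
    rw [map_zero, kerCotangentToTensor_toCotangent]
    exact H a ha
  rw [Ideal.toCotangent_eq_zero] at this
  exact hker ▸ (show a ∈ RingHom.ker (algebraMap R (ResidueField R)) ^ 2 from this)

theorem exists_D_eq_zero {k R : Type} [CommRing k] [CommRing R] [IsLocalRing R]
    [Algebra k R] [Algebra.FormallySmooth k R]
    (h : ¬ Algebra.FormallySmooth k (ResidueField R)) :
    ∃ a ∈ maximalIdeal R, a ∉ maximalIdeal R ^ 2 ∧
      (1 ⊗ₜ D k R a : ResidueField R ⊗[R] Ω[R⁄k]) = 0 := by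
  by_contra! H
  refine h ⟨inferInstance, ?_⟩
  rw [← Algebra.FormallySmooth.kerCotangentToTensor_injective_iff (R := k) (P := R)
    (A := ResidueField R) residue_surjective, injective_iff_map_eq_zero]
  intro x hx
  have hker : RingHom.ker (algebraMap R (ResidueField R)) = maximalIdeal R := ker_residue
  obtain ⟨⟨a, ha⟩, rfl⟩ := Ideal.toCotangent_surjective _ x
  rw [kerCotangentToTensor_toCotangent] at hx
  rw [Ideal.toCotangent_eq_zero]
  by_contra h2
  change a ∉ RingHom.ker (algebraMap R (ResidueField R)) ^ 2 at h2
  rw [hker] at ha h2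
  exact H a ha h2 hx

theorem exists_arc_of_formallySmooth {k R : Type} [CommRing k] [CommRing R] [IsLocalRing R]
    [IsNoetherianRing R] [Algebra k R] [Algebra.FormallySmooth k R]
    [Algebra.FormallySmooth k (ResidueField R)] [Module.Finite R Ω[R⁄k]] (hR : ¬ IsField R)
    (L : Type) [Field L] [Algebra (ResidueField R) L] [Algebra k L]
    [IsScalarTower k (ResidueField R) L] (hL : ¬ Module.Finite (ResidueField R) L) :
    ∃ (ψ : ResidueField R ⊗[R] Ω[R⁄k] →ₗ[ResidueField R] L) (α : R →ₐ[k] L⟦X⟧),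
      Function.Injective ψ ∧
      (∀ r, constantCoeff (α r) = algebraMap (ResidueField R) L (residue R r)) ∧
      (∀ r, coeff 1 (α r) = ψ (1 ⊗ₜ D k R r)) ∧ ∃ a ∈ maximalIdeal R, α a ≠ 0 := by
  obtain ⟨ψ, hψ⟩ := exists_injective_of_infinite (V := ResidueField R ⊗[R] Ω[R⁄k]) hL
  let : Algebra R L := ((algebraMap (ResidueField R) L).comp (residue R)).toAlgebra
  have : IsScalarTower R (ResidueField R) L := .of_algebraMap_eq fun _ ↦ rfl
  have : IsScalarTower k R L := .of_algebraMap_eq fun x ↦ by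
    rw [IsScalarTower.algebraMap_apply k (ResidueField R) L,
      IsScalarTower.algebraMap_apply k R (ResidueField R),
      IsScalarTower.algebraMap_apply R (ResidueField R) L]
  let D' : Derivation k R L :=
    (((ψ.restrictScalars R) ∘ₗ TensorProduct.mk R (ResidueField R) Ω[R⁄k] 1).compDer (D k R))
  obtain ⟨α, h0, h1⟩ := exists_arc D'
  refine ⟨ψ, α, hψ, h0, h1, ?_⟩
  obtain ⟨a, ha, hD⟩ := exists_D_ne_zero (k := k) hR
  refine ⟨a, ha, fun h ↦ hD (hψ ?_)⟩
  rw [map_zero]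
  have := h1 a
  rw [h, map_zero] at this
  exact this.symm

end

theorem isIso_morphismRestrict_of_section {X Y : Scheme.{0}} (f : X ⟶ Y) [IsSeparated f]
    [IsIntegral X] [IsIntegral Y] {W : Y.Opens} (hW : Dense (W : Set Y)) [IsIso (f ∣_ W)]
    {V : Y.Opens} (hV : (V : Set Y).Nonempty) (s : V.toScheme ⟶ X) (hs : s ≫ f = V.ι) :
    IsIso (f ∣_ V) := by
  have hr : Set.range s ⊆ Set.range (f ⁻¹ᵁ V).ι := by
    rintro _ ⟨x, rfl⟩
    rw [Scheme.Opens.range_ι]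
    change f (s x) ∈ V
    rw [← Scheme.Hom.comp_apply, hs]
    exact x.2
  let s' : V.toScheme ⟶ (f ⁻¹ᵁ V) := IsOpenImmersion.lift (f ⁻¹ᵁ V).ι s hr
  have hs' : s' ≫ (f ⁻¹ᵁ V).ι = s := IsOpenImmersion.lift_fac _ _ _
  have h1 : s' ≫ f ∣_ V = 𝟙 _ := by
    rw [← cancel_mono V.ι, Category.assoc, morphismRestrict_ι, reassoc_of% hs', hs,
      Category.id_comp]
  have : IsClosedImmersion (s' ≫ f ∣_ V) := by rw [h1]; infer_instance
  have : IsClosedImmersion s' := .of_comp s' (f ∣_ V)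
  have hinj : ∀ a b : X, f a ∈ W → f a = f b → a = b := by
    intro a b ha hab
    have hW' : ∀ z w : (f ⁻¹ᵁ W).toScheme, f z.1 = f w.1 → z = w := fun z w h ↦
      (f ∣_ W).isOpenEmbedding.injective (Subtype.ext (by
        rw [morphismRestrict_base_coe, morphismRestrict_base_coe, h]))
    exact congrArg Subtype.val (hW' ⟨a, ha⟩ ⟨b, by change f b ∈ W; rwa [← hab]⟩ hab)
  have hpre : ∀ y ∈ W, ∃ x, f x = y := by
    intro y hy
    obtain ⟨x, hx⟩ := (f ∣_ W).surjective ⟨y, hy⟩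
    exact ⟨x.1, by rw [← morphismRestrict_base_coe, hx]⟩
  have h3 : ∀ v, (f ⁻¹ᵁ V).ι (s' v) = s v := fun v ↦ by rw [← Scheme.Hom.comp_apply, hs']
  have h4 : ∀ v : V.toScheme, f (s v) = v.1 := fun v ↦ by
    rw [← Scheme.Hom.comp_apply, hs]
    rfl
  have : Surjective s' := by
    constructor
    rw [← Set.range_eq_univ]
    obtain ⟨y, hyV, hyW⟩ := hW.inter_open_nonempty V V.isOpen hV
    obtain ⟨x, rfl⟩ := hpre y hyW
    have hsub : ((f ⁻¹ᵁ V).ι ⁻¹ᵁ f ⁻¹ᵁ W : Set (f ⁻¹ᵁ V).toScheme) ⊆ Set.range s' := by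
      rintro ⟨z, hzV⟩ hzW
      refine ⟨⟨f z, hzV⟩, ?_⟩
      apply (f ⁻¹ᵁ V).ι.injective
      exact (h3 _).trans (hinj z _ hzW (h4 ⟨f z, hzV⟩).symm).symm
    have : Nonempty (f ⁻¹ᵁ V).toScheme := ⟨⟨x, hyV⟩⟩
    have hd := ((f ⁻¹ᵁ V).ι ⁻¹ᵁ f ⁻¹ᵁ W).isOpen.dense ⟨⟨x, hyV⟩, hyW⟩
    rw [← (s'.isClosedEmbedding.isClosed_range).closure_eq]
    exact (hd.mono hsub).closure_eq
  have := isIso_of_isClosedImmersion_of_surjective s'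
  exact IsIso.of_isIso_fac_left h1

theorem exists_isIso_morphismRestrict_of_section {X Y : Scheme.{0}} (f : X ⟶ Y) [IsSeparated f]
    [LocallyOfFiniteType f]
    [IsIntegral X] [IsIntegral Y] {W : Y.Opens} (hW : Dense (W : Set Y)) [IsIso (f ∣_ W)]
    {y : Y} (σ : Spec (Y.presheaf.stalk y) ⟶ X) (hσ : σ ≫ f = Y.fromSpecStalk y) :
    ∃ V : Y.Opens, y ∈ V ∧ IsIso (f ∣_ V) := by
  obtain ⟨V, hy, s, -, hs⟩ := spread_out_of_isGermInjective' (𝟙 Y) f σ (by rw [hσ]; simp)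
  exact ⟨V, hy, isIso_morphismRestrict_of_section f hW ⟨y, hy⟩ s (by simpa using hs)⟩

theorem isIso_of_exists_morphismRestrict {X Y : Scheme.{0}} (f : X ⟶ Y)
    (h : ∀ y, ∃ V : Y.Opens, y ∈ V ∧ IsIso (f ∣_ V)) : IsIso f := by
  choose V hV h using h
  have := (IsZariskiLocalAtTarget.iff_of_iSup_eq_top (P := MorphismProperty.isomorphisms Scheme)
    (f := f) V (by
      rw [eq_top_iff]; intro y _
      exact TopologicalSpace.Opens.mem_iSup.mpr ⟨y, hV y⟩)).mpr h
  exact this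

/-- `f` is an isomorphism over a neighbourhood of `y`. -/
def IsIsoNear {X Y : Scheme.{0}} (f : X ⟶ Y) (y : Y) : Prop :=
  ∃ V : Y.Opens, y ∈ V ∧ IsIso (f ∣_ V)

theorem epi_stalkMap_comp {X Y : Scheme.{0}} (f : X ⟶ Y) (x : X)
    (h : ∀ z, f z ⤳ f x → f z ≠ f x → IsIsoNear f (f z)) {L : CommRingCat.{0}} [IsLocalRing L]
    (loc : X.presheaf.stalk x ⟶ L) [Epi loc]
    (hP : (IsLocalRing.maximalIdeal L).comap (f.stalkMap x ≫ loc).hom ≠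
      IsLocalRing.maximalIdeal (Y.presheaf.stalk (f x))) :
    Epi (f.stalkMap x ≫ loc) := by
  let j : Spec L ⟶ X := Spec.map loc ≫ X.fromSpecStalk x
  have : Mono (Spec.map loc) := inferInstanceAs (Mono (Scheme.Spec.map loc.op))
  have : Mono j := mono_comp _ _
  have hj : j ≫ f = Spec.map (f.stalkMap x ≫ loc) ≫ Y.fromSpecStalk (f x) := by
    simp [j, Spec.map_comp]
  let c : Spec L := IsLocalRing.closedPoint L
  have hfz : f (j c) = Y.fromSpecStalk (f x) (Spec.map (f.stalkMap x ≫ loc) c) := by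
    rw [← Scheme.Hom.comp_apply, hj, Scheme.Hom.comp_apply]
  obtain ⟨V, hzV, hV⟩ := h (j c) (by
      rw [hfz]
      exact (Set.ext_iff.mp (Scheme.range_fromSpecStalk (x := f x)) _).mp ⟨_, rfl⟩) (by
      intro heq
      have h2 := (Y.fromSpecStalk (f x)).isEmbedding.injective
        ((hfz.symm.trans heq).trans Scheme.fromSpecStalk_closedPoint.symm)
      exact hP (congrArg PrimeSpectrum.asIdeal h2))
  have htop : j ⁻¹ᵁ (f ⁻¹ᵁ V) = ⊤ := Scheme.preimage_eq_top_of_closedPoint_mem j hzV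
  have hr : Set.range j ⊆ Set.range (f ⁻¹ᵁ V).ι := by
    rw [Scheme.Opens.range_ι]
    rintro _ ⟨a, rfl⟩
    exact (htop ▸ TopologicalSpace.Opens.mem_top a : a ∈ j ⁻¹ᵁ f ⁻¹ᵁ V)
  let l := IsOpenImmersion.lift (f ⁻¹ᵁ V).ι j hr
  have hl : l ≫ (f ⁻¹ᵁ V).ι = j := IsOpenImmersion.lift_fac _ _ _
  have : Mono (l ≫ (f ⁻¹ᵁ V).ι) := by rw [hl]; infer_instance
  have : Mono l := mono_of_mono l (f ⁻¹ᵁ V).ι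
  have : Mono (Spec.map (f.stalkMap x ≫ loc) ≫ Y.fromSpecStalk (f x)) := by
    rw [← hj, ← hl, Category.assoc, ← morphismRestrict_ι]
    infer_instance
  have : Mono (Spec.map (f.stalkMap x ≫ loc)) := mono_of_mono _ (Y.fromSpecStalk (f x))
  have : Mono (f.stalkMap x ≫ loc).op := Scheme.Spec.mono_of_mono_map this
  exact unop_epi_of_mono (f.stalkMap x ≫ loc).op

theorem isEpi_localization_stalk {X Y : Scheme.{0}} (f : X ⟶ Y) (x : X)
    (h : ∀ z, f z ⤳ f x → f z ≠ f x → IsIsoNear f (f z)) {R O : Type} [CommRing R]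
    [CommRing O] [IsLocalRing R] [Algebra R O] (eR : Y.presheaf.stalk (f x) ≅ .of R)
    (eO : X.presheaf.stalk x ≅ .of O)
    (he : eR.hom ≫ CommRingCat.ofHom (algebraMap R O) = f.stalkMap x ≫ eO.hom) (P : Ideal O)
    [P.IsPrime] (hP : P.comap (algebraMap R O) ≠ IsLocalRing.maximalIdeal R) :
    Algebra.IsEpi R (Localization.AtPrime P) := by
  rw [← CommRingCat.epi_iff_epi]
  let loc : X.presheaf.stalk x ⟶ .of (Localization.AtPrime P) :=
    eO.hom ≫ CommRingCat.ofHom (algebraMap O _)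
  have : Epi loc := epi_comp _ _
  have hloc : eR.hom ≫ CommRingCat.ofHom (algebraMap R (Localization.AtPrime P)) =
      f.stalkMap x ≫ loc := by
    rw [← reassoc_of% he]
    rfl
  have h1 := epi_stalkMap_comp f x h loc (by
    rw [← hloc]
    intro heq
    apply hP
    have h2 := congrArg (Ideal.comap eR.inv.hom) heq
    rw [Ideal.comap_comap, ← CommRingCat.hom_comp, Iso.inv_hom_id_assoc] at h2
    have h3 : (IsLocalRing.maximalIdeal (Y.presheaf.stalk (f x))).comap eR.inv.hom =
        IsLocalRing.maximalIdeal R :=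
      IsLocalRing.eq_maximalIdeal (Ideal.comap_isMaximal_of_equiv
        eR.symm.commRingCatIsoToRingEquiv)
    rw [← h3, ← h2]
    exact (congrArg (Ideal.comap (algebraMap R O))
      (Localization.AtPrime.under_maximalIdeal (I := P))).symm)
  rw [← hloc] at h1
  exact epi_of_epi eR.hom _

theorem injective_stalkSpecializes {Y : Scheme.{0}} [IsIntegral Y] {y η : Y}
    (h : η = genericPoint Y) (h' : η ⤳ y) :
    Function.Injective (Y.presheaf.stalkSpecializes h').hom ∧ IsField (Y.presheaf.stalk η) := by
  subst h
  exact ⟨IsFractionRing.injective (Y.presheaf.stalk y) Y.functionField,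
    Field.toIsField Y.functionField⟩

theorem injective_stalkMap {X Y : Scheme.{0}} (f : X ⟶ Y) [IsIntegral X] [IsIntegral Y]
    [IsDominant f] (x : X) : Function.Injective (f.stalkMap x).hom := by
  have h : f (genericPoint X) = genericPoint Y := by
    exact (genericPoint_spec Y).eq (by
      simpa [f.denseRange.closure_range] using (genericPoint_spec X).image f.continuous) |>.symm
  have h' := genericPoint_specializes x
  obtain ⟨h1, h2⟩ := injective_stalkSpecializes h (h'.map f.continuous)
  let := h2.toField
  have h3 : Function.Injective (f.stalkMap (genericPoint X)).hom := RingHom.injective _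
  have h4 := h3.comp h1
  have h5 := Scheme.Hom.stalkSpecializes_stalkMap f _ _ h'
  have h6 : Function.Injective ((X.presheaf.stalkSpecializes h').hom ∘ (f.stalkMap x).hom) := by
    rw [← RingHom.coe_comp, ← CommRingCat.hom_comp, ← h5]
    exact h4
  exact h6.of_comp

theorem isIsoNear_of_bijective {X Y : Scheme.{0}} (f : X ⟶ Y) [IsSeparated f]
    [LocallyOfFiniteType f] [IsIntegral X] [IsIntegral Y] {W : Y.Opens}
    (hW : Dense (W : Set Y)) [IsIso (f ∣_ W)] (x : X)
    (h : Function.Bijective (f.stalkMap x).hom) : IsIsoNear f (f x) := by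
  have : IsIso (f.stalkMap x) := (ConcreteCategory.isIso_iff_bijective _).mpr h
  refine exists_isIso_morphismRestrict_of_section f hW
    (Spec.map (inv (f.stalkMap x)) ≫ X.fromSpecStalk x) ?_
  rw [Category.assoc, ← Scheme.SpecMap_stalkMap_fromSpecStalk, ← Spec.map_comp_assoc]
  simp

theorem flat_stalkMap_of_formallySmooth {X Y : Scheme.{0}} (f : X ⟶ Y)
    [LocallyOfFinitePresentation f] (x : X) (h : (f.stalkMap x).hom.FormallySmooth) :
    (f.stalkMap x).hom.Flat := by
  let U : X.Opens := f.smoothLocus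
  have : Smooth (U.ι ≫ f) := by
    rw [← Scheme.Hom.smoothLocus_eq_top_iff, ← Scheme.Hom.preimage_smoothLocus_eq]
    simp [U]
  obtain ⟨u, rfl⟩ : ∃ u : U.toScheme, U.ι u = x := ⟨⟨x, h⟩, rfl⟩
  have h1 := Flat.stalkMap (U.ι ≫ f) u
  rw [Scheme.Hom.stalkMap_comp] at h1
  have h3 : f.stalkMap (U.ι u) = (f.stalkMap (U.ι u) ≫ U.ι.stalkMap u) ≫
      (asIso (U.ι.stalkMap u)).inv := by simp
  rw [h3]
  exact RingHom.Flat.respectsIso.1 _ (asIso (U.ι.stalkMap u)).symm.commRingCatIsoToRingEquiv h1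

theorem isIsoNear_of_isField {X Y : Scheme.{0}} (f : X ⟶ Y) [IsIntegral Y] {W : Y.Opens}
    (hW : Dense (W : Set Y)) [IsIso (f ∣_ W)] (y : Y) (h : IsField (Y.presheaf.stalk y)) :
    IsIsoNear f y := by
  let := h.toField
  have h1 : genericPoint Y ⤳ y := genericPoint_specializes y
  obtain ⟨p, hp⟩ : genericPoint Y ∈ Set.range (Y.fromSpecStalk y) :=
    (Set.ext_iff.mp (Scheme.range_fromSpecStalk (x := y)) _).mpr h1
  have : p = IsLocalRing.closedPoint _ := Subsingleton.elim (α := PrimeSpectrum _) _ _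
  have hy : genericPoint Y = y := by
    rw [← hp, this]
    exact Scheme.fromSpecStalk_closedPoint
  refine ⟨W, ?_, inferInstance⟩
  rw [← hy]
  obtain ⟨w, hw⟩ := hW.nonempty
  exact (genericPoint_specializes w).mem_open W.isOpen hw

theorem algebraMap_bijective_of_flat_of_isEpi {R O : Type} [CommRing R] [CommRing O] [IsDomain R]
    [IsDomain O] [IsLocalRing R] [IsLocalRing O] [Algebra R O]
    [IsLocalHom (algebraMap R O)] [Module.Flat R O]
    [Algebra.IsEpi R (Localization.AtPrime (⊥ : Ideal O))] :
    Function.Bijective (algebraMap R O) := by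
  have : Module.FaithfullyFlat R O := .of_flat_of_isLocalHom
  have hinj : Function.Injective (algebraMap R O) := FaithfulSMul.algebraMap_injective R O
  have := isEpi_fractionRing R O
  have := isFractionRing_of_isEpi (R := R) (K := FractionRing O) (by
    rw [IsScalarTower.algebraMap_eq R O]
    exact (IsFractionRing.injective O _).comp hinj)
  refine algebraMap_bijective_of_flat fun a ↦ ?_
  obtain ⟨⟨r, s⟩, hrs⟩ := IsLocalization.surj (nonZeroDivisors R)
    (algebraMap O (FractionRing O) a)
  refine ⟨r, s, ?_, ?_⟩
  · rw [Ne, map_eq_zero_iff _ hinj]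
    exact nonZeroDivisors.ne_zero s.2
  · apply IsFractionRing.injective O (FractionRing O)
    simpa [IsScalarTower.algebraMap_apply R O (FractionRing O), mul_comm] using hrs

theorem isIsoNear_of_formallySmooth {X Y : Scheme.{0}} (f : X ⟶ Y) [IsSeparated f]
    [LocallyOfFinitePresentation f] [IsIntegral X] [IsIntegral Y] [IsDominant f] {W : Y.Opens}
    (hW : Dense (W : Set Y)) [IsIso (f ∣_ W)] (x : X)
    (h : (f.stalkMap x).hom.FormallySmooth)
    (hgen : ∀ z, f z ⤳ f x → f z ≠ f x → IsIsoNear f (f z)) : IsIsoNear f (f x) := by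
  by_contra hx
  have hfield : ¬ IsField (Y.presheaf.stalk (f x)) := fun h ↦ hx (isIsoNear_of_isField f hW _ h)
  apply hx
  apply isIsoNear_of_bijective f hW
  let : Algebra (Y.presheaf.stalk (f x)) (X.presheaf.stalk x) := (f.stalkMap x).hom.toAlgebra
  have : Module.Flat (Y.presheaf.stalk (f x)) (X.presheaf.stalk x) :=
    flat_stalkMap_of_formallySmooth f x h
  have : IsLocalHom (algebraMap (Y.presheaf.stalk (f x)) (X.presheaf.stalk x)) :=
    inferInstanceAs (IsLocalHom (f.stalkMap x).hom)
  have hinj : Function.Injective (algebraMap (Y.presheaf.stalk (f x)) (X.presheaf.stalk x)) :=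
    injective_stalkMap f x
  let eR : Y.presheaf.stalk (f x) ≅ .of (Y.presheaf.stalk (f x)) := Iso.refl _
  let eO : X.presheaf.stalk x ≅ .of (X.presheaf.stalk x) := Iso.refl _
  have := isEpi_localization_stalk f x hgen eR eO
    ((Category.id_comp _).trans (Category.comp_id _).symm) ⊥ (by
      rw [← RingHom.ker_eq_comap_bot, (RingHom.injective_iff_ker_eq_bot _).mp hinj]
      exact fun h ↦ hfield (IsLocalRing.isField_iff_maximalIdeal_eq.mpr h.symm))
  exact algebraMap_bijective_of_flat_of_isEpi

theorem exists_map_eq_fromSpecStalk (k : Type) [CommRing k] (p : Spec (CommRingCat.of k)) :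
    ∃ τ : CommRingCat.of k ⟶ (Spec (CommRingCat.of k)).presheaf.stalk p,
      Spec.map τ = (Spec (CommRingCat.of k)).fromSpecStalk p ∧ τ.hom.FormallySmooth ∧
        τ.hom.EssFiniteType := by
  let p : PrimeSpectrum k := p
  let := StructureSheaf.stalkAlgebra k p
  have h : IsLocalization.AtPrime ((Spec.structureSheaf k).presheaf.stalk p) p.asIdeal :=
    StructureSheaf.IsLocalization.to_stalk k p
  have h1 : Algebra.FormallySmooth k ((Spec.structureSheaf k).presheaf.stalk p) :=
    .of_isLocalization p.asIdeal.primeCompl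
  have h2 : Algebra.EssFiniteType k ((Spec.structureSheaf k).presheaf.stalk p) :=
    .of_isLocalization _ p.asIdeal.primeCompl
  exact ⟨StructureSheaf.toStalk k p, (Spec.fromSpecStalk_eq' _ _).symm, h1, h2⟩

theorem exists_algebra_stalk {k : Type} [Field k] {X : Scheme.{0}}
    (sX : X ⟶ Spec (CommRingCat.of k)) [Smooth sX] (x : X) :
    ∃ φ : CommRingCat.of k ⟶ X.presheaf.stalk x, Spec.map φ = X.fromSpecStalk x ≫ sX ∧
      φ.hom.FormallySmooth ∧ φ.hom.EssFiniteType := by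
  have h1 : (sX.stalkMap x).hom.FormallySmooth := by
    rw [← Scheme.Hom.mem_smoothLocus, Scheme.Hom.smoothLocus_eq_top]
    trivial
  have h2 : (sX.stalkMap x).hom.EssFiniteType := LocallyOfFiniteType.stalkMap sX x
  obtain ⟨τ, hτ, h3, h4⟩ := exists_map_eq_fromSpecStalk k (sX x)
  refine ⟨τ ≫ sX.stalkMap x, ?_, ?_, ?_⟩
  · rw [← Scheme.SpecMap_stalkMap_fromSpecStalk, Spec.map_comp, hτ]
  · exact h3.comp h1
  · exact h4.comp h2

theorem exists_specializes_maximal {Y : Type*} [TopologicalSpace Y] [QuasiSober Y] [T0Space Y]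
    {Z : Set Y} (hZ : IsClosed Z) (hne : Z.Nonempty) :
    ∃ y ∈ Z, ∀ z ∈ Z, z ⤳ y → z = y := by
  obtain ⟨y₀, hy₀⟩ := hne
  have : QuasiSober Z := hZ.isClosedEmbedding_subtypeVal.quasiSober
  obtain ⟨y, hy⟩ := QuasiSober.sober (isIrreducible_irreducibleComponent (x := (⟨y₀, hy₀⟩ : Z)))
    isClosed_irreducibleComponent
  refine ⟨y, y.2, fun z hz hzy ↦ ?_⟩
  have h1 : (⟨z, hz⟩ : Z) ⤳ y := Topology.IsInducing.subtypeVal.specializes_iff.mp hzy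
  have h2 : closure {(⟨z, hz⟩ : Z)} = irreducibleComponent ⟨y₀, hy₀⟩ :=
    eq_irreducibleComponent isIrreducible_singleton.closure.isPreirreducible (by
      rw [← hy.def]
      exact h1.closure_subset)
  have h3 : y ⤳ (⟨z, hz⟩ : Z) := by
    rw [specializes_iff_closure_subset, h2, hy.def]
  exact congrArg Subtype.val (h1.antisymm h3).eq

theorem exists_not_isIsoNear {X Y : Scheme.{0}} (f : X ⟶ Y) (h : ¬ IsIso f) :
    ∃ y, ¬ IsIsoNear f y ∧ ∀ z, z ⤳ y → z ≠ y → IsIsoNear f z := by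
  have hZ : IsClosed {y | ¬ IsIsoNear f y} := by
    rw [← isOpen_compl_iff, isOpen_iff_forall_mem_open]
    intro y hy
    obtain ⟨V, hyV, hV⟩ := not_not.mp hy
    exact ⟨V, fun z hz ↦ not_not.mpr ⟨V, hz, hV⟩, V.isOpen, hyV⟩
  have hne : {y | ¬ IsIsoNear f y}.Nonempty := by
    by_contra hne
    refine h (isIso_of_exists_morphismRestrict f fun y ↦ ?_)
    by_contra hy
    exact hne ⟨y, hy⟩
  obtain ⟨y, hy, hmax⟩ := exists_specializes_maximal hZ hne
  exact ⟨y, hy, fun z hz hne ↦ by_contra fun h ↦ hne (hmax z h hz)⟩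

theorem exists_lift_of_valuationRing {X Y : Scheme.{0}} (f : X ⟶ Y) [UniversallyClosed f]
    {A K : Type} [CommRing A] [IsDomain A] [ValuationRing A] [Field K] [Algebra A K]
    [IsFractionRing A K] (p : Spec (.of K) ⟶ X) (i : Spec (.of A) ⟶ Y)
    (h : p ≫ f = Spec.map (CommRingCat.ofHom (algebraMap A K)) ≫ i) :
    ∃ l : Spec (.of A) ⟶ X,
      Spec.map (CommRingCat.ofHom (algebraMap A K)) ≫ l = p ∧ l ≫ f = i := by
  have hc : ValuativeCriterion.Existence f := (UniversallyClosed.eq_valuativeCriterion.le _ _ _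
    (inferInstance : UniversallyClosed f)).1
  obtain ⟨l, hl, hl2⟩ := (hc { R := A, K := K, i₁ := p, i₂ := i, commSq := ⟨h⟩ }).exists_lift
  exact ⟨l, hl, hl2⟩

theorem exists_lift_of_isIsoNear {X Y : Scheme.{0}} (f : X ⟶ Y) [IsProper f] {A K : Type}
    [CommRing A] [IsDomain A] [ValuationRing A] [Field K] [Algebra A K] [IsFractionRing A K]
    (i : Spec (.of A) ⟶ Y)
    (c : Spec (.of K)) (h : IsIsoNear f (i (Spec.map (CommRingCat.ofHom (algebraMap A K)) c))) :
    ∃ l : Spec (.of A) ⟶ X, l ≫ f = i := by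
  obtain ⟨V, hV, hf⟩ := h
  let j : Spec (.of K) ⟶ Y := Spec.map (CommRingCat.ofHom (algebraMap A K)) ≫ i
  let j' : Spec (.of K) ⟶ V := IsOpenImmersion.lift V.ι j (by
    rintro _ ⟨x, rfl⟩
    rw [Scheme.Opens.range_ι]
    have : x = c := Subsingleton.elim (α := PrimeSpectrum K) _ _
    rw [this]
    simpa [j] using hV)
  have hj' : j' ≫ V.ι = j := IsOpenImmersion.lift_fac _ _ _
  obtain ⟨l, -, hl⟩ := exists_lift_of_valuationRing f (j' ≫ inv (f ∣_ V) ≫ (f ⁻¹ᵁ V).ι) i (by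
    rw [Category.assoc, Category.assoc, ← morphismRestrict_ι, IsIso.inv_hom_id_assoc, hj'])
  exact ⟨l, hl⟩

theorem exists_stalk_lift {X Y : Scheme.{0}} (f : X ⟶ Y) [IsProper f] (y : Y)
    (hgen : ∀ z, z ⤳ y → z ≠ y → IsIsoNear f z) {A : Type}
    [CommRing A] [IsDomain A] [ValuationRing A] (α : Y.presheaf.stalk y ⟶ .of A)
    [IsLocalHom α.hom]
    (hα : ∃ a ∈ IsLocalRing.maximalIdeal (Y.presheaf.stalk y), α.hom a ≠ 0) :
    ∃ (x : X) (hx : f x = y) (β : X.presheaf.stalk x ⟶ .of A), IsLocalHom β.hom ∧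
      Y.presheaf.stalkSpecializes (specializes_of_eq hx) ≫ f.stalkMap x ≫ β = α := by
  let K := FractionRing A
  let c : Spec (.of K) := IsLocalRing.closedPoint K
  let t : Spec (.of A) := Spec.map (CommRingCat.ofHom (algebraMap A K)) c
  have ht : t.asIdeal = ⊥ := by
    change (IsLocalRing.maximalIdeal K).comap (algebraMap A K) = ⊥
    rw [IsLocalRing.maximalIdeal_eq_bot, ← RingHom.ker_eq_comap_bot]
    exact (RingHom.injective_iff_ker_eq_bot _).mp (IsFractionRing.injective A K)
  obtain ⟨l, hl⟩ := exists_lift_of_isIsoNear f (Spec.map α ≫ Y.fromSpecStalk y) c (by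
    refine hgen _ ?_ ?_
    · rw [Scheme.Hom.comp_apply]
      exact (Set.ext_iff.mp (Scheme.range_fromSpecStalk (x := y)) _).mp ⟨_, rfl⟩
    · intro heq
      rw [Scheme.Hom.comp_apply] at heq
      have h2 := (Y.fromSpecStalk y).isEmbedding.injective
        (heq.trans Scheme.fromSpecStalk_closedPoint.symm)
      obtain ⟨a, ha, ha'⟩ := hα
      have h3 : a ∈ (Spec.map α t).asIdeal := by
        rw [h2]
        exact ha
      have h4 : α.hom a ∈ t.asIdeal := h3
      rw [ht] at h4
      exact ha' h4)
  let a : Spec (.of A) := IsLocalRing.closedPoint A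
  have hx : f (l a) = y := by
    rw [← Scheme.Hom.comp_apply, hl, Scheme.Hom.comp_apply]
    exact (congrArg (Y.fromSpecStalk y) (Spec_closedPoint (f := α))).trans
      Scheme.fromSpecStalk_closedPoint
  refine ⟨_, hx, Scheme.stalkClosedPointTo l, inferInstance, ?_⟩
  apply Spec.map_injective
  rw [← cancel_mono (Y.fromSpecStalk y), Spec.map_comp, Category.assoc,
    Scheme.SpecMap_stalkSpecializes_fromSpecStalk, Spec.map_comp, Category.assoc,
    Scheme.SpecMap_stalkMap_fromSpecStalk, ← Category.assoc,
    Scheme.Spec_stalkClosedPointTo_fromSpecStalk, hl]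

theorem exists_extension_of_valuationRing {S T X : Scheme.{0}} [IsIntegral T] [X.IsSeparated]
    (sT : T ⟶ S) (sX : X ⟶ S) [IsProper sX] (p : Spec T.functionField ⟶ X)
    (hp : p ≫ sX = T.fromSpecStalk (genericPoint T) ≫ sT) :
    ∃ (D : T.Opens) (g : D.toScheme ⟶ X),
      (∀ t : T, ValuationRing (T.presheaf.stalk t) → t ∈ D) ∧
      ∀ j : Spec T.functionField ⟶ D.toScheme, j ≫ D.ι = T.fromSpecStalk (genericPoint T) →
        j ≫ g = p := by
  let r := Scheme.RationalMap.ofFunctionField sT sX p hp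
  have hr : r.fromFunctionField = p := Scheme.RationalMap.fromFunctionField_ofFunctionField _ _ _ _
  refine ⟨r.domain, r.toPartialMap.hom, fun t ht ↦ ?_, fun j hj ↦ ?_⟩
  · have hs : Spec.map (CommRingCat.ofHom (algebraMap (T.presheaf.stalk t) T.functionField)) ≫
        T.fromSpecStalk t = T.fromSpecStalk (genericPoint T) :=
      Scheme.SpecMap_stalkSpecializes_fromSpecStalk (genericPoint_specializes t)
    have : IsDomain (T.presheaf.stalk t) :=
      (IsFractionRing.injective (T.presheaf.stalk t) T.functionField).isDomain _
    obtain ⟨q, hl1, hl2⟩ := @exists_lift_of_valuationRing _ _ sX _ (T.presheaf.stalk t)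
      T.functionField _ this ht _ _ _ p (T.fromSpecStalk t ≫ sT) (by
        rw [hp, ← hs, Category.assoc])
    let P := Scheme.PartialMap.ofFromSpecStalk sT sX q hl2
    have hP : P.fromSpecStalkOfMem (Scheme.PartialMap.mem_domain_ofFromSpecStalk sT sX q hl2) = q :=
      Scheme.PartialMap.fromSpecStalkOfMem_ofFromSpecStalk _ _ _ _
    refine Scheme.RationalMap.mem_domain.mpr ⟨P,
      Scheme.PartialMap.mem_domain_ofFromSpecStalk sT sX q hl2, ?_⟩
    apply Scheme.RationalMap.eq_of_fromFunctionField_eq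
    rw [hr, Scheme.RationalMap.fromFunctionField_toRationalMap]
    refine Eq.trans ?_ hl1
    rw [← hP]
    rw [Scheme.PartialMap.fromFunctionField, Scheme.PartialMap.fromSpecStalkOfMem,
      Scheme.PartialMap.fromSpecStalkOfMem, ← Category.assoc]
    congr 1
    rw [← cancel_mono P.domain.ι, Category.assoc]
    simp [hs]
  · have h1 : r.toPartialMap.fromFunctionField = p := by
      rw [← Scheme.RationalMap.fromFunctionField_toRationalMap,
        Scheme.RationalMap.toRationalMap_toPartialMap, hr]
    rw [← h1]
    refine congrArg (· ≫ r.toPartialMap.hom) ?_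
    exact (cancel_mono r.toPartialMap.domain.ι).mp <|
      hj.trans (Scheme.Opens.fromSpecStalkOfMem_ι r.domain _ _).symm

open Polynomial in
theorem exists_C_mem_of_valuationRing (A κ : Type) [CommRing A] [IsDomain A] [Field κ]
    [Algebra A κ] [IsFractionRing A κ] (D : TopologicalSpace.Opens (PrimeSpectrum A[X]))
    (hD : ∀ t : Spec (.of A[X]), ValuationRing ((Spec (.of A[X])).presheaf.stalk t) → t ∈ D) :
    ∃ s : A, s ≠ 0 ∧ PrimeSpectrum.basicOpen (C s : A[X]) ≤ D := by
  obtain ⟨I, hI⟩ := (PrimeSpectrum.isClosed_iff_zeroLocus_ideal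
    ((D : Set (PrimeSpectrum A[X]))ᶜ)).mp D.isOpen.isClosed_compl
  by_cases hdis : Disjoint (I : Set A[X]) ((nonZeroDivisors A).map (C : A →+* A[X]))
  · exfalso
    obtain ⟨P, hP, hIP, hPd⟩ := Ideal.exists_le_prime_disjoint I _ hdis
    let t : PrimeSpectrum A[X] := ⟨P, hP⟩
    have ht : t ∈ ((D : Set (PrimeSpectrum A[X]))ᶜ) := by
      rw [hI]
      exact hIP
    refine ht (hD t ?_)
    let := StructureSheaf.stalkAlgebra A[X] t
    have := StructureSheaf.IsLocalization.to_stalk A[X] t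
    have hdom (t : Spec (.of A[X])) : IsDomain ((Spec (.of A[X])).presheaf.stalk t) := inferInstance
    have hdom : IsDomain ((Spec.structureSheaf A[X]).presheaf.stalk t) := hdom t
    refine valuationRing_of_isLocalization_polynomial A κ
      (O := (Spec.structureSheaf A[X]).presheaf.stalk t) t.asIdeal fun a ha ↦ ?_
    by_contra h0
    exact Set.disjoint_left.mp hPd ha ⟨a, mem_nonZeroDivisors_of_ne_zero h0, rfl⟩
  · obtain ⟨_, hx, s, hs, rfl⟩ := Set.not_disjoint_iff.mp hdis
    refine ⟨s, nonZeroDivisors.ne_zero hs, fun t ht ↦ ?_⟩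
    by_contra h
    have ht' : t ∈ ((D : Set (PrimeSpectrum A[X]))ᶜ) := h
    rw [hI] at ht'
    exact ht (ht' hx)

theorem exists_isIso_spec_functionField (R : CommRingCat.{0}) [IsDomain R] (L : Type) [Field L]
    [Algebra R L] [IsFractionRing R L] :
    ∃ e : Spec (Spec R).functionField ⟶ Spec (.of L), IsIso e ∧
      e ≫ Spec.map (CommRingCat.ofHom (algebraMap R L)) =
        (Spec R).fromSpecStalk (genericPoint (Spec R)) := by
  let e : L ≃ₐ[R] (Spec R).functionField :=
    IsLocalization.algEquiv (nonZeroDivisors R) L (Spec R).functionField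
  have : IsIso (CommRingCat.ofHom e.toRingEquiv.toRingHom) :=
    (RingEquiv.toCommRingCatIso e.toRingEquiv).isIso_hom
  have h : IsIso (Spec.map (CommRingCat.ofHom e.toRingEquiv.toRingHom)) := inferInstance
  refine ⟨Spec.map (CommRingCat.ofHom e.toRingEquiv.toRingHom), h, ?_⟩
  refine (Spec.map_comp _ _).symm.trans (Eq.trans ?_ (Spec.fromSpecStalk_eq' _ _).symm)
  congr 1
  ext1
  exact e.toAlgHom.comp_algebraMap

open Polynomial in
theorem exists_polynomial_extension {S X : Scheme.{0}} [X.IsSeparated] (A κ L : Type) [CommRing A]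
    [IsDomain A] [Field κ] [Algebra A κ] [IsFractionRing A κ] [Field L] [Algebra A[X] L]
    [IsFractionRing A[X] L] (sT : Spec (.of A[X]) ⟶ S) (sX : X ⟶ S) [IsProper sX]
    (p : Spec (.of L) ⟶ X)
    (hp : p ≫ sX = Spec.map (CommRingCat.ofHom (algebraMap A[X] L)) ≫ sT) :
    ∃ s : A, s ≠ 0 ∧ ∀ (A' : Type) [CommRing A'] [Algebra A A'], IsUnit (algebraMap A A' s) →
      ∃ h : Spec (.of A'[X]) ⟶ X, ∀ ρ : A'[X] →+* L,
        ρ.comp (mapRingHom (algebraMap A A')) = algebraMap A[X] L →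
        Spec.map (CommRingCat.ofHom ρ) ≫ h = p := by
  let T := Spec (.of A[X])
  obtain ⟨e', _, he⟩ := exists_isIso_spec_functionField (.of A[X]) L
  obtain ⟨D, g, hD, hg⟩ := exists_extension_of_valuationRing sT sX (e' ≫ p) (by
    rw [Category.assoc, hp, ← Category.assoc, he])
  obtain ⟨s, hs, hsD⟩ := exists_C_mem_of_valuationRing A κ D hD
  refine ⟨s, hs, fun A' _ _ hu ↦ ?_⟩
  let m : Spec (.of A'[X]) ⟶ T := Spec.map (CommRingCat.ofHom (mapRingHom (algebraMap A A')))
  have hm : Set.range m ⊆ Set.range D.ι := by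
    rw [Scheme.Opens.range_ι]
    rintro _ ⟨t, rfl⟩
    refine hsD fun hmem ↦ ?_
    refine t.2.ne_top (Ideal.eq_top_of_isUnit_mem _ (x := C (algebraMap A A' s)) ?_ (hu.map C))
    have : mapRingHom (algebraMap A A') (C s) ∈ t.asIdeal := hmem
    simpa using this
  refine ⟨IsOpenImmersion.lift D.ι m hm ≫ g, fun ρ hρ ↦ ?_⟩
  rw [← cancel_epi e', ← hg (e' ≫ Spec.map (CommRingCat.ofHom ρ) ≫ IsOpenImmersion.lift D.ι m hm)]
  · simp
  · simp only [Category.assoc, IsOpenImmersion.lift_fac]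
    rw [← he, ← Spec.map_comp, ← CommRingCat.ofHom_comp, hρ]

section
open Polynomial
attribute [local instance] Polynomial.algebra

theorem isPullback_spec_polynomial (k A : Type) [Field k] [CommRing A] [Algebra k A] :
    IsPullback (Spec.map (CommRingCat.ofHom (C : A →+* A[X])))
      (Spec.map (CommRingCat.ofHom (mapRingHom (algebraMap k A))))
      (Spec.map (CommRingCat.ofHom (algebraMap k A))) (a1Struct k) :=
  isPullback_SpecMap_of_isPushout _ _ _ _
    (CommRingCat.isPushout_of_isPushout k A (Polynomial k) (Polynomial A))

theorem isFractionRing_polynomial (A κ L : Type) [CommRing A] [IsDomain A] [Field κ] [Algebra A κ]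
    [IsFractionRing A κ] [Field L] [Algebra κ[X] L] [IsFractionRing κ[X] L] [Algebra A[X] L]
    [IsScalarTower A[X] κ[X] L] : IsFractionRing A[X] L := by
  have : IsLocalization ((nonZeroDivisors A).map (C : A →+* A[X])) κ[X] :=
    Polynomial.isLocalization (nonZeroDivisors A) κ
  have : FaithfulSMul A[X] L := by
    rw [faithfulSMul_iff_algebraMap_injective, IsScalarTower.algebraMap_eq A[X] κ[X] L]
    exact (IsFractionRing.injective κ[X] L).comp
      (Polynomial.map_injective _ (IsFractionRing.injective A κ))
  refine IsFractionRing.of_field _ _ fun z ↦ ?_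
  obtain ⟨u, v, hv, rfl⟩ := IsFractionRing.div_surjective (A := κ[X]) z
  obtain ⟨⟨a, s⟩, hs⟩ := IsLocalization.surj ((nonZeroDivisors A).map (C : A →+* A[X])) u
  obtain ⟨⟨b, t⟩, ht⟩ := IsLocalization.surj ((nonZeroDivisors A).map (C : A →+* A[X])) v
  have hv0 : algebraMap κ[X] L v ≠ 0 := IsFractionRing.to_map_ne_zero_of_mem_nonZeroDivisors hv
  have h1 := congrArg (algebraMap κ[X] L) hs
  have h2 := congrArg (algebraMap κ[X] L) ht
  have h3 := ((IsLocalization.map_units κ[X] s).map (algebraMap κ[X] L)).ne_zero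
  have h4 := ((IsLocalization.map_units κ[X] t).map (algebraMap κ[X] L)).ne_zero
  simp only [map_mul, ← IsScalarTower.algebraMap_apply] at h1 h2 h3 h4
  refine ⟨a * t, b * s, ?_⟩
  rw [map_mul, map_mul, ← h1, ← h2]
  field_simp

theorem A1Rigid.exists_map_comp_eq {k : Type} [Field k] {X : Scheme} {sX : X ⟶ Spec (.of k)}
    (hX : A1Rigid k X sX) [IsProper sX] (κ L : Type) [Field κ] [Field L] [Algebra k κ]
    [Algebra.EssFiniteType k κ] [Algebra.FormallySmooth k κ] [Algebra κ[X] L]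
    [IsFractionRing κ[X] L] (p : Spec (.of L) ⟶ X)
    (hp : p ≫ sX = Spec.map (CommRingCat.ofHom
      (((algebraMap κ[X] L).comp C).comp (algebraMap k κ)))) :
    ∃ q : Spec (.of κ) ⟶ X,
      Spec.map (CommRingCat.ofHom ((algebraMap κ[X] L).comp C)) ≫ q = p := by
  obtain ⟨A, _, _, _, _, _, _⟩ := exists_smooth_isFractionRing k κ
  have : IsDomain A := (IsFractionRing.injective A κ).isDomain _
  have : X.IsSeparated := ⟨by
    rw [← terminal.comp_from sX]
    infer_instance⟩
  let : Algebra A[X] L := ((algebraMap κ[X] L).comp (mapRingHom (algebraMap A κ))).toAlgebra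
  have : IsScalarTower A[X] κ[X] L := .of_algebraMap_eq fun _ ↦ rfl
  have : IsFractionRing A[X] L := isFractionRing_polynomial A κ L
  obtain ⟨s, hs, H⟩ := exists_polynomial_extension A κ L
    (Spec.map (CommRingCat.ofHom ((C : A →+* A[X]).comp (algebraMap k A)))) sX p (by
      rw [hp, ← Spec.map_comp, ← CommRingCat.ofHom_comp]
      congr 2
      ext x
      simp [IsScalarTower.algebraMap_apply A[X] κ[X] L, IsScalarTower.algebraMap_apply k A κ])
  obtain ⟨_, _, _, _, _⟩ := exists_away_isFractionRing k (κ := κ) hs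
  let A' := Localization.Away s
  obtain ⟨h, hh⟩ := H A' (IsLocalization.Away.algebraMap_isUnit s)
  let ρ : A'[X] →+* L := (algebraMap κ[X] L).comp (mapRingHom (algebraMap A' κ))
  have hρinj : Function.Injective ρ := (IsFractionRing.injective κ[X] L).comp
      (Polynomial.map_injective _ (IsFractionRing.injective A' κ))
  have hρ := hh ρ (by
    rw [IsScalarTower.algebraMap_eq A[X] κ[X] L, Polynomial.algebraMap_def,
      IsScalarTower.algebraMap_eq A A' κ, RingHom.comp_assoc, mapRingHom_comp])
  have hsm : Algebra.Smooth k A' := by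
    have : Algebra.Smooth A A' := .of_isLocalization_Away s
    exact .comp k A A'
  let sU : Spec (.of A') ⟶ Spec (.of k) := Spec.map (CommRingCat.ofHom (algebraMap k A'))
  have hsU : Smooth sU := by
    rw [HasRingHomProperty.Spec_iff (P := @Smooth)]
    exact RingHom.smooth_algebraMap.mpr hsm
  have P := isPullback_spec_polynomial k A'
  have hsX : h ≫ sX = Spec.map (CommRingCat.ofHom (C : A' →+* A'[X])) ≫ sU := by
    obtain ⟨φ, hφ⟩ := Spec.map_surjective (h ≫ sX)
    have h1 : Spec.map (CommRingCat.ofHom ρ) ≫ h ≫ sX = Spec.map (CommRingCat.ofHom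
        (((algebraMap κ[X] L).comp C).comp (algebraMap k κ))) := by rw [← Category.assoc, hρ, hp]
    rw [← hφ, ← Spec.map_comp, Spec.map_inj] at h1
    rw [← hφ, ← Spec.map_comp, Spec.map_inj]
    refine CommRingCat.hom_ext (RingHom.ext fun x ↦ hρinj ?_)
    refine (congr($h1 x)).trans ?_
    simp [ρ, IsScalarTower.algebraMap_apply k A' κ]
  obtain ⟨q, -, hq⟩ := (hX _ sU hsU inferInstance inferInstance inferInstance).2
    (P.isoPullback.inv ≫ h) (by rw [Category.assoc, hsX, P.isoPullback_inv_fst_assoc])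
  have hq' : Spec.map (CommRingCat.ofHom (C : A' →+* A'[X])) ≫ q = h := by
    rw [← P.isoPullback_hom_fst, Category.assoc, hq, Iso.hom_inv_id_assoc]
  refine ⟨Spec.map (CommRingCat.ofHom (algebraMap A' κ)) ≫ q, ?_⟩
  rw [← hρ, ← hq', ← Category.assoc, ← Category.assoc, ← Spec.map_comp, ← Spec.map_comp]
  congr 2
  ext x
  simp [ρ]
end

section
open IsLocalRing KaehlerDifferential TensorProduct PowerSeries

theorem exists_specMap_comp_fromSpecStalk {X : Scheme.{0}} {κ L : Type} [Field κ] [Field L]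
    [Algebra κ L] (q : Spec (.of κ) ⟶ X) (x : X) (ρ : X.presheaf.stalk x ⟶ .of L)
    [IsLocalHom ρ.hom]
    (h : Spec.map (CommRingCat.ofHom (algebraMap κ L)) ≫ q = Spec.map ρ ≫ X.fromSpecStalk x) :
    ∃ θ : X.presheaf.stalk x ⟶ .of κ, θ ≫ CommRingCat.ofHom (algebraMap κ L) = ρ := by
  let c : Spec (.of L) := closedPoint L
  have hx : q (closedPoint κ) = x := by
    have h1 : Spec.map ρ c = closedPoint _ := comap_closedPoint ρ.hom
    have h2 : Spec.map (CommRingCat.ofHom (algebraMap κ L)) c = closedPoint κ :=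
      comap_closedPoint (algebraMap κ L)
    have h3 := congr($h c)
    rw [Scheme.Hom.comp_apply, Scheme.Hom.comp_apply, h1, h2] at h3
    exact h3.trans X.fromSpecStalk_closedPoint
  subst hx
  refine ⟨Scheme.stalkClosedPointTo q, ?_⟩
  rw [← Spec.map_inj, Spec.map_comp, ← cancel_mono (X.fromSpecStalk _), Category.assoc,
    Scheme.Spec_stalkClosedPointTo_fromSpecStalk, h]

theorem not_finite_ratFunc (κ : Type) [Field κ] : ¬ Module.Finite κ (RatFunc κ) := by
  intro h
  refine Polynomial.not_finite (R := κ) (Module.Finite.of_injective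
    (IsScalarTower.toAlgHom κ (Polynomial κ) (RatFunc κ)).toLinearMap
    (IsFractionRing.injective (Polynomial κ) (RatFunc κ)))

theorem A1Rigid.isIsoNear_of_formallySmooth_residueField {k : Type} [Field k] {X Y : Scheme}
    {sX : X ⟶ Spec (.of k)} (hX : A1Rigid k X sX) [IsProper sX] [Smooth sX]
    {sY : Y ⟶ Spec (.of k)} [IsIntegral X] [IsIntegral Y] (f : X ⟶ Y) [IsProper f]
    [LocallyOfFinitePresentation f] [IsDominant f] (hf : f ≫ sY = sX) {W : Y.Opens}
    (hW : Dense (W : Set Y)) [IsIso (f ∣_ W)] (y : Y)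
    (hgen : ∀ z, z ⤳ y → z ≠ y → IsIsoNear f z)
    (φ : .of k ⟶ Y.presheaf.stalk y) (hφ : Spec.map φ = Y.fromSpecStalk y ≫ sY)
    (hφs : φ.hom.FormallySmooth) (hφf : φ.hom.EssFiniteType)
    (hres : ((residue (Y.presheaf.stalk y)).comp φ.hom).FormallySmooth) : IsIsoNear f y := by
  by_contra hbad
  have hfield : ¬ IsField (Y.presheaf.stalk y) := fun h ↦ hbad (isIsoNear_of_isField f hW _ h)
  let : Algebra k (Y.presheaf.stalk y) := φ.hom.toAlgebra
  have : Algebra.FormallySmooth k (Y.presheaf.stalk y) := hφs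
  have : Algebra.EssFiniteType k (Y.presheaf.stalk y) := hφf
  have : IsNoetherianRing (Y.presheaf.stalk y) := Algebra.EssFiniteType.isNoetherianRing k _
  let κ := ResidueField (Y.presheaf.stalk y)
  have : Algebra.FormallySmooth k κ := hres
  have : Algebra.EssFiniteType k κ := .comp k (Y.presheaf.stalk y) κ
  let L := RatFunc κ
  have : IsScalarTower k κ L := .of_algebraMap_eq fun _ ↦ rfl
  obtain ⟨ψ, α, hψ, hα0, hα1, hα⟩ := exists_arc_of_formallySmooth (k := k) hfield L
    (not_finite_ratFunc κ)
  have hαloc : IsLocalHom (CommRingCat.ofHom α.toRingHom).hom := ⟨fun r hr ↦ by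
    have h1 : IsUnit (algebraMap κ L (residue _ r)) := by
      rw [← hα0]
      exact hr.map constantCoeff
    rw [← residue_ne_zero_iff_isUnit]
    intro h
    rw [h, map_zero] at h1
    exact not_isUnit_zero h1⟩
  obtain ⟨x, hx, β, hβ, hβα⟩ := exists_stalk_lift f y hgen (CommRingCat.ofHom α.toRingHom) hα
  subst hx
  have hβα' : f.stalkMap x ≫ β = CommRingCat.ofHom α.toRingHom := by
    refine Eq.trans ?_ hβα
    rw [TopCat.Presheaf.stalkSpecializes_refl, Category.id_comp]
  obtain ⟨φX, hφX, hφXs, hφXf⟩ := exists_algebra_stalk sX x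
  have hcomp : φ ≫ f.stalkMap x = φX := by
    rw [← Spec.map_inj, Spec.map_comp, hφ, hφX, Scheme.SpecMap_stalkMap_fromSpecStalk_assoc, hf]
  let : Algebra k (X.presheaf.stalk x) := φX.hom.toAlgebra
  let : Algebra (Y.presheaf.stalk (f x)) (X.presheaf.stalk x) := (f.stalkMap x).hom.toAlgebra
  have : IsScalarTower k (Y.presheaf.stalk (f x)) (X.presheaf.stalk x) :=
    .of_algebraMap_eq fun c ↦ congr($(hcomp.symm) c)
  have : Algebra.FormallySmooth k (X.presheaf.stalk x) := hφXs
  have : Algebra.EssFiniteType k (X.presheaf.stalk x) := hφXf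
  have hβα'' (r : Y.presheaf.stalk (f x)) :
      β.hom (algebraMap (Y.presheaf.stalk (f x)) (X.presheaf.stalk x) r) = α r :=
    congr($hβα' r)
  let β' : X.presheaf.stalk x →ₐ[k] L⟦X⟧ :=
    { β.hom with
      commutes' c := by
        rw [← α.commutes c, ← hβα'']
        exact congr(β.hom ($(hcomp.symm) c)) }
  have hβ' : IsLocalHom β' := ⟨fun r hr ↦ hβ.map_nonunit r hr⟩
  let ρ : X.presheaf.stalk x ⟶ .of L := β ≫ CommRingCat.ofHom (constantCoeff (R := L))
  have hρ : IsLocalHom ρ.hom := ⟨fun r hr ↦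
    hβ.map_nonunit r (PowerSeries.isUnit_iff_constantCoeff.mpr hr)⟩
  have hp : (Spec.map ρ ≫ X.fromSpecStalk x) ≫ sX = Spec.map (CommRingCat.ofHom
      (((algebraMap (Polynomial κ) L).comp Polynomial.C).comp (algebraMap k κ))) := by
    rw [Category.assoc, ← hφX, ← Spec.map_comp, Spec.map_inj, ← hcomp]
    ext c
    change constantCoeff (β.hom (algebraMap _ _ (φ.hom c))) = _
    rw [hβα'', hα0]
    rfl
  obtain ⟨q, hq⟩ := hX.exists_map_comp_eq κ L (Spec.map ρ ≫ X.fromSpecStalk x) hp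
  obtain ⟨θ, hθ⟩ := exists_specMap_comp_fromSpecStalk (κ := κ) (L := L) q x ρ hq
  refine hbad (isIsoNear_of_formallySmooth f hW x ?_ fun z ↦ hgen (f z))
  refine formallySmooth_of_injective_residue (k := k) (R := Y.presheaf.stalk (f x))
    (O := X.presheaf.stalk x) (injective_residue_of_arc ψ hψ β' (fun r ↦ ?_) (fun r ↦ ?_)
      fun b ↦ ⟨θ.hom b, congr($(hθ.symm) b)⟩)
  · exact (congrArg (coeff 1) (hβα'' r)).trans (hα1 r)
  · exact (congrArg constantCoeff (hβα'' r)).trans (hα0 r)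
end

section
open IsLocalRing KaehlerDifferential TensorProduct

theorem isIsoNear_of_valuationRing {X Y : Scheme.{0}} [IsIntegral X] [IsIntegral Y] (f : X ⟶ Y)
    [IsProper f] {W : Y.Opens} (hW : Dense (W : Set Y)) [IsIso (f ∣_ W)] (y : Y)
    (hgen : ∀ z, z ⤳ y → z ≠ y → IsIsoNear f z) [ValuationRing (Y.presheaf.stalk y)] :
    IsIsoNear f y := by
  by_contra hbad
  have hfield : ¬ IsField (Y.presheaf.stalk y) := fun h ↦ hbad (isIsoNear_of_isField f hW _ h)
  let α : Y.presheaf.stalk y ⟶ .of (Y.presheaf.stalk y) := 𝟙 _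
  have hα : IsLocalHom α.hom := ⟨fun _ h ↦ h⟩
  obtain ⟨x, hx, β, -, hβ⟩ := exists_stalk_lift f y hgen α
    (Submodule.exists_mem_ne_zero_of_ne_bot fun h ↦ hfield (isField_iff_maximalIdeal_eq.mpr h))
  subst hx
  have hβ' : f.stalkMap x ≫ β = α := by
    refine Eq.trans ?_ hβ
    rw [TopCat.Presheaf.stalkSpecializes_refl, Category.id_comp]
  refine hbad (exists_isIso_morphismRestrict_of_section f hW
    (Spec.map β ≫ X.fromSpecStalk x) ?_)
  rw [Category.assoc, ← Scheme.SpecMap_stalkMap_fromSpecStalk, ← Spec.map_comp_assoc, hβ']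
  exact (congrArg (· ≫ _) (Spec.map_id _)).trans (Category.id_comp _)

theorem exists_isPrime_comap_stalkMap {X Y : Scheme.{0}} (f : X ⟶ Y) [IsProper f]
    [IsDominant f] (y : Y) (q : Ideal (Y.presheaf.stalk y)) [q.IsPrime] :
    ∃ (x : X) (hx : f x = y) (P : Ideal (X.presheaf.stalk x)), P.IsPrime ∧
      P.comap (Y.presheaf.stalkSpecializes (specializes_of_eq hx) ≫ f.stalkMap x).hom = q := by
  let q' : Spec (Y.presheaf.stalk y) := ⟨q, ‹_›⟩
  have hsurj : Function.Surjective f := by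
    rw [← Set.range_eq_univ, ← f.isClosedMap.isClosed_range.closure_eq, f.denseRange.closure_range]
  obtain ⟨x', hx'⟩ := hsurj (Y.fromSpecStalk y q')
  have hz : Y.fromSpecStalk y q' ⤳ y :=
    (Set.ext_iff.mp (Scheme.range_fromSpecStalk (x := y)) _).mp ⟨q', rfl⟩
  obtain ⟨x, hx, rfl⟩ := f.isClosedMap.specializingMap (hx' ▸ hz : f x' ⤳ y)
  obtain ⟨P, hP⟩ : x' ∈ Set.range (X.fromSpecStalk x) :=
    (Set.ext_iff.mp (Scheme.range_fromSpecStalk (x := x)) _).mpr hx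
  refine ⟨x, rfl, P.asIdeal, P.2, ?_⟩
  have h : Spec.map (f.stalkMap x) P = q' := by
    apply (Y.fromSpecStalk (f x)).isEmbedding.injective
    rw [← hx', ← hP, ← Scheme.Hom.comp_apply, ← Scheme.Hom.comp_apply,
      Scheme.SpecMap_stalkMap_fromSpecStalk]
  rw [TopCat.Presheaf.stalkSpecializes_refl, Category.id_comp]
  exact congrArg PrimeSpectrum.asIdeal h

theorem isIsoNear_of_not_formallySmooth_residueField {k : Type} [Field k] {X Y : Scheme.{0}}
    {sX : X ⟶ Spec (.of k)} [Smooth sX]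
    {sY : Y ⟶ Spec (.of k)} [IsIntegral X] [IsIntegral Y] (f : X ⟶ Y) [IsProper f]
    [LocallyOfFinitePresentation f] [IsDominant f] (hf : f ≫ sY = sX) {W : Y.Opens}
    (hW : Dense (W : Set Y)) [IsIso (f ∣_ W)] (y : Y)
    (hgen : ∀ z, z ⤳ y → z ≠ y → IsIsoNear f z)
    (φ : .of k ⟶ Y.presheaf.stalk y) (hφ : Spec.map φ = Y.fromSpecStalk y ≫ sY)
    (hφs : φ.hom.FormallySmooth) (hφf : φ.hom.EssFiniteType)
    (hres : ¬ ((residue (Y.presheaf.stalk y)).comp φ.hom).FormallySmooth) : IsIsoNear f y := by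
  let : Algebra k (Y.presheaf.stalk y) := φ.hom.toAlgebra
  have : Algebra.FormallySmooth k (Y.presheaf.stalk y) := hφs
  have : Algebra.EssFiniteType k (Y.presheaf.stalk y) := hφf
  have : IsNoetherianRing (Y.presheaf.stalk y) := Algebra.EssFiniteType.isNoetherianRing k _
  obtain ⟨g, hg, hg2, hD⟩ := exists_D_eq_zero (k := k) (R := Y.presheaf.stalk y) hres
  by_cases hm : Ideal.span {g} = maximalIdeal (Y.presheaf.stalk y)
  · have hP : (maximalIdeal (Y.presheaf.stalk y)).IsPrincipal := ⟨g, hm.symm⟩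
    have : ValuationRing (Y.presheaf.stalk y) := by
      have h := (tfae_of_isNoetherianRing_of_isLocalRing_of_isDomain (Y.presheaf.stalk y)).out 4 1
      exact h.mp hP
    exact isIsoNear_of_valuationRing f hW y hgen
  have := isPrime_span_singleton k hg hg2
  obtain ⟨x, hx, P, hP, hPq⟩ := exists_isPrime_comap_stalkMap f y (Ideal.span {g})
  subst hx
  rw [TopCat.Presheaf.stalkSpecializes_refl, Category.id_comp] at hPq
  obtain ⟨φX, hφX, hφXs, hφXf⟩ := exists_algebra_stalk sX x
  have hcomp : φ ≫ f.stalkMap x = φX := by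
    rw [← Spec.map_inj, Spec.map_comp, hφ, hφX, Scheme.SpecMap_stalkMap_fromSpecStalk_assoc, hf]
  let : Algebra k (X.presheaf.stalk x) := φX.hom.toAlgebra
  let : Algebra (Y.presheaf.stalk (f x)) (X.presheaf.stalk x) := (f.stalkMap x).hom.toAlgebra
  have : IsScalarTower k (Y.presheaf.stalk (f x)) (X.presheaf.stalk x) :=
    .of_algebraMap_eq fun c ↦ congr($(hcomp.symm) c)
  have : Algebra.FormallySmooth k (X.presheaf.stalk x) := hφXs
  have : Algebra.EssFiniteType k (X.presheaf.stalk x) := hφXf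
  have : IsNoetherianRing (X.presheaf.stalk x) := Algebra.EssFiniteType.isNoetherianRing k _
  have : IsLocalHom (algebraMap (Y.presheaf.stalk (f x)) (X.presheaf.stalk x)) :=
    inferInstanceAs (IsLocalHom (f.stalkMap x).hom)
  let eR : Y.presheaf.stalk (f x) ≅ .of (Y.presheaf.stalk (f x)) := Iso.refl _
  let eO : X.presheaf.stalk x ≅ .of (X.presheaf.stalk x) := Iso.refl _
  have hPq' : P.comap (algebraMap (Y.presheaf.stalk (f x)) (X.presheaf.stalk x)) =
    Ideal.span {g} := hPq
  refine isIsoNear_of_formallySmooth f hW x ?_ fun z ↦ hgen (f z)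
  refine formallySmooth_of_height_one k (R := Y.presheaf.stalk (f x))
    (O := X.presheaf.stalk x) (injective_stalkMap f x) (fun P _ hP ↦
      isEpi_localization_stalk f x (fun z ↦ hgen (f z)) eR eO
        ((Category.id_comp _).trans (Category.comp_id _).symm) P hP) hg hg2 hD P ?_ (hPq' ▸ hm)
  rw [← Ideal.mem_comap, hPq']
  exact Ideal.mem_span_singleton_self g

theorem A1Rigid.isIso_of_isProper {k : Type} [Field k] {X Y : Scheme}
    {sX : X ⟶ Spec (.of k)} (hX : A1Rigid k X sX) [IsProper sX] [Smooth sX]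
    {sY : Y ⟶ Spec (.of k)} [Smooth sY] [IsIntegral X] [IsIntegral Y] (f : X ⟶ Y) [IsProper f]
    (hf : f ≫ sY = sX) {W : Y.Opens} (hW : Dense (W : Set Y)) [IsIso (f ∣_ W)] : IsIso f := by
  have : IsLocallyNoetherian Y := LocallyOfFiniteType.isLocallyNoetherian sY
  have : LocallyOfFinitePresentation f :=
    LocallyOfFinitePresentation.iff_locallyOfFiniteType.mpr inferInstance
  have : IsDominant f := by
    refine ⟨hW.mono fun y hy ↦ ?_⟩
    have h : Function.Surjective (f ∣_ W) := (f ∣_ W).surjective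
    obtain ⟨x, hx⟩ := h ⟨y, hy⟩
    exact ⟨x.1, by rw [← morphismRestrict_base_coe, hx]⟩
  by_contra h
  obtain ⟨y, hbad, hgen⟩ := exists_not_isIsoNear f h
  obtain ⟨φ, hφ, hφs, hφf⟩ := exists_algebra_stalk sY y
  by_cases hres : ((residue (Y.presheaf.stalk y)).comp φ.hom).FormallySmooth
  · exact hbad (hX.isIsoNear_of_formallySmooth_residueField f hf hW y hgen φ hφ hφs hφf hres)
  · exact hbad (isIsoNear_of_not_formallySmooth_residueField f hf hW y hgen φ hφ hφs hφf hres)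
end

/-- Let `X` be a smooth proper integral `k`-scheme which is `𝔸¹`-rigid, let `Y` be a smooth
integral separated finite-type `k`-scheme and let `f : X ⟶ Y` be a proper `k`-morphism which
restricts to an isomorphism over a dense open subscheme of `Y` (a proper birational morphism).
Then `f` is an isomorphism.  Hence the `𝔸¹`-homotopy type of a smooth proper `𝔸¹`-rigid
variety is `𝔸¹`-minimal. -/
theorem a1Rigid_proper_birational_isIso
    (k : Type) [Field k]
    (X Y : Scheme) (sX : X ⟶ Spec (CommRingCat.of k)) (sY : Y ⟶ Spec (CommRingCat.of k))
    (hXsm : IsSmooth sX) (hXproper : IsProper sX) (hXqc : QuasiCompact sX)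
    (hXint : IsIntegral X) (hXrigid : A1Rigid k X sX)
    (hYsm : IsSmooth sY) (hYsep : IsSeparated sY)
    (hYlft : LocallyOfFiniteType sY) (hYqc : QuasiCompact sY) (hYint : IsIntegral Y)
    (f : X ⟶ Y) (hf : f ≫ sY = sX) (hfproper : IsProper f)
    (hbir : ∃ V : Y.Opens, Dense (V : Set Y) ∧ IsIso (f ∣_ V)) :
    IsIso f := by
  obtain ⟨W, hW, _⟩ := hbir
  have : Smooth sX := hXsm
  have : Smooth sY := hYsm
  exact hXrigid.isIso_of_isProper f hf hW

end
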